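/- arXiv:2102.04793 — 6 statements merged into one kernel-verified Lean document; each statement's English description precedes it below -/
import Mathlib

section
/- Let T̄ be an upper transition operator on ℒ(X). Then T̄ is weakly ergodic if and only if T̄ satisfies (TCA). -/
open Filter Topology

namespace WeakErg

variable {X : Type*} [Fintype X] [Nonempty X]

/-- Indicator function of a set, as a real-valued function. -/
noncomputable def ind (A : Set X) : X → ℝ := A.indicator 1

/-- Upper transition operator axioms: dominated by the max, sub-additive,
non-negatively homogeneous. -/
def IsUTO (T : (X → ℝ) → (X → ℝ)) : Prop :=
  (∀ (h : X → ℝ) (x : X), T h x ≤ ⨆ y, h y) ∧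
  (∀ (h g : X → ℝ) (x : X), T (h + g) x ≤ T h x + T g x) ∧
  (∀ (l : ℝ), 0 ≤ l → ∀ h : X → ℝ, T (l • h) = l • T h)

/-- The topical map `T̄_f : h ↦ f + T̄ h`. -/
def Tf (T : (X → ℝ) → (X → ℝ)) (f : X → ℝ) : (X → ℝ) → (X → ℝ) :=
  fun h => f + T h

/-- Edge relation of the (upper) accessibility graph 𝒢(T): an edge from `x` to `y`
iff `[T 𝟙_y](x) > 0`. -/
def Edge (T : (X → ℝ) → (X → ℝ)) (x y : X) : Prop := 0 < T (ind {y}) x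

/-- Accessibility: `x = y` or there is a directed path from `x` to `y`. -/
def Acc' (T : (X → ℝ) → (X → ℝ)) : X → X → Prop := Relation.ReflTransGen (Edge T)

/-- `x` and `y` communicate. -/
def Comm (T : (X → ℝ) → (X → ℝ)) (x y : X) : Prop := Acc' T x y ∧ Acc' T y x

/-- `S` is a communication class: an equivalence class of the communication relation. -/
def IsCommClass (T : (X → ℝ) → (X → ℝ)) (S : Set X) : Prop :=
  ∃ x : X, S = {y | Comm T x y}

/-- A nonempty set `S` is closed in 𝒢(T): no state outside `S` is accessible from `S`. -/
def ClosedIn (T : (X → ℝ) → (X → ℝ)) (S : Set X) : Prop :=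
  S.Nonempty ∧ ∀ x ∈ S, ∀ y ∉ S, ¬ Acc' T x y

/-- 𝒢(T) is strongly connected. -/
def StronglyConnected (T : (X → ℝ) → (X → ℝ)) : Prop := ∀ x y : X, Acc' T x y

/-- A set `S` is absorbing for `T`: from each state outside `S` the `k`-step upper
probability of staying outside `S` drops below 1 for some `k`. -/
def Absorbing (T : (X → ℝ) → (X → ℝ)) (S : Set X) : Prop :=
  ∀ x ∉ S, ∃ k : ℕ, T^[k] (ind Sᶜ) x < 1

/-- `R` is a top class of 𝒢(T): a communication class accessible from every state. -/
def IsTopClass (T : (X → ℝ) → (X → ℝ)) (R : Set X) : Prop :=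
  IsCommClass T R ∧ ∀ x : X, ∀ y ∈ R, Acc' T x y

/-- (TCA): 𝒢(T) has a top class that is absorbing. -/
def TCA (T : (X → ℝ) → (X → ℝ)) : Prop :=
  ∃ R : Set X, IsTopClass T R ∧ Absorbing T R

/-- `T` is weakly ergodic: for every `f`, the upper expected time averages
`(1/k)·[T̄_f^k(0)](x)` converge to a limit independent of `x`. -/
def WeaklyErgodic (T : (X → ℝ) → (X → ℝ)) : Prop :=
  ∀ f : X → ℝ, ∃ μ : ℝ, ∀ x : X,
    Tendsto (fun k : ℕ => (1 / (k : ℝ)) * (Tf T f)^[k] 0 x) atTop (𝓝 μ)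

/-- `μ` is an additive eigenvalue of `G`. -/
def IsAddEigenvalue (G : (X → ℝ) → (X → ℝ)) (μ : ℝ) : Prop :=
  ∃ h : X → ℝ, G h = h + fun _ => μ

/-- A transition matrix on `X`: nonnegative entries with rows summing to one. -/
structure TransMat (Y : Type*) [Fintype Y] where
  P : Y → Y → ℝ
  nonneg : ∀ x y, 0 ≤ P x y
  rowSum : ∀ x, ∑ y, P x y = 1

/-- The action of a transition matrix on functions. -/
def TransMat.apply (T : TransMat X) (h : X → ℝ) : X → ℝ :=
  fun x => ∑ y, T.P x y * h y

/-- A set of transition matrices is separately specified. -/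
def SepSpec (𝒯 : Set (TransMat X)) : Prop :=
  ∀ T₁ ∈ 𝒯, ∀ T₂ ∈ 𝒯, ∀ A : Set X, ∃ T₃ ∈ 𝒯,
    (∀ x ∈ A, T₃.P x = T₁.P x) ∧ (∀ y ∉ A, T₃.P y = T₂.P y)

/-- `Tbar` is the upper envelope of the set `𝒯` of transition matrices. -/
def IsUpperEnv (𝒯 : Set (TransMat X)) (Tbar : (X → ℝ) → (X → ℝ)) : Prop :=
  ∀ (h : X → ℝ) (x : X), Tbar h x = ⨆ T : 𝒯, TransMat.apply T.1 h x

/-- The repetition-independent upper expected time average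
`sup_{T ∈ 𝒯} (1/k)·[T_f^k(0)](x)`. -/
noncomputable def riSeq (𝒯 : Set (TransMat X)) (f : X → ℝ) (x : X) (k : ℕ) : ℝ :=
  ⨆ T : 𝒯, (1 / (k : ℝ)) * (Tf (TransMat.apply T.1) f)^[k] 0 x

/-- Weak ergodicity of the imprecise Markov chain under repetition independence. -/
def RIWeaklyErgodic (𝒯 : Set (TransMat X)) : Prop :=
  ∀ f : X → ℝ, ∃ μ : ℝ, ∀ x : X, Tendsto (riSeq 𝒯 f x) atTop (𝓝 μ)

end WeakErg

namespace WeakErg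

section aux

set_option linter.unusedSectionVars false

variable {X : Type*} [Fintype X] [Nonempty X] {T : (X → ℝ) → (X → ℝ)}

lemma uto_zero (hT : IsUTO T) : T 0 = 0 := by
  have := hT.2.2 0 le_rfl 0
  simpa using this

lemma uto_le (hT : IsUTO T) {h : X → ℝ} {c : ℝ} (hc : ∀ y, h y ≤ c) (x : X) : T h x ≤ c :=
  (hT.1 h x).trans (ciSup_le hc)

lemma uto_mono (hT : IsUTO T) {h g : X → ℝ} (hg : h ≤ g) : T h ≤ T g := by
  intro x
  have h1 := hT.2.1 (h - g) g x
  have h2 : T (h - g) x ≤ 0 := uto_le hT (fun y => by simpa using hg y) x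
  rw [sub_add_cancel] at h1
  linarith

lemma uto_add_const (hT : IsUTO T) (h : X → ℝ) (c : ℝ) (x : X) :
    T (fun y => h y + c) x = T h x + c := by
  have key : ∀ (g : X → ℝ) (d : ℝ), T (fun y => g y + d) x ≤ T g x + d := by
    intro g d
    have h1 := hT.2.1 g (fun _ => d) x
    have h2 : T (fun _ => d) x ≤ d := uto_le hT (fun y => le_rfl) x
    have h3 : g + (fun _ => d) = fun y => g y + d := rfl
    rw [h3] at h1
    linarith
  apply le_antisymm (key h c)
  have := key (fun y => h y + c) (-c)
  simp only [add_neg_cancel_right] at this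
  linarith

lemma uto_nonneg (hT : IsUTO T) {h : X → ℝ} (hh : 0 ≤ h) : 0 ≤ T h := by
  have := uto_mono hT hh
  rwa [uto_zero hT] at this

lemma uto_nonexp (hT : IsUTO T) (h g : X → ℝ) : ‖T h - T g‖ ≤ ‖h - g‖ := by
  have key : ∀ (a b : X → ℝ) (x : X), T a x - T b x ≤ ‖a - b‖ := by
    intro a b x
    have h1 := hT.2.1 (a - b) b x
    have h2 : T (a - b) x ≤ ‖a - b‖ :=
      uto_le hT (fun y => (le_abs_self _).trans (norm_le_pi_norm (a - b) y)) x
    rw [sub_add_cancel] at h1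
    linarith
  refine (pi_norm_le_iff_of_nonneg (norm_nonneg _)).2 fun x => ?_
  rw [Real.norm_eq_abs, Pi.sub_apply, abs_le]
  have h1 := key h g x
  have h2 := key g h x
  rw [norm_sub_rev] at h2
  constructor <;> linarith

lemma uto_cont (hT : IsUTO T) : Continuous T := by
  have : LipschitzWith 1 T := LipschitzWith.of_dist_le_mul fun a b => by
    simpa [dist_eq_norm] using uto_nonexp hT a b
  exact this.continuous

lemma iter_mono (hT : IsUTO T) (k : ℕ) : Monotone (T^[k]) :=
  Monotone.iterate (fun _ _ h => uto_mono hT h) k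

lemma iter_smul (hT : IsUTO T) (k : ℕ) {l : ℝ} (hl : 0 ≤ l) (h : X → ℝ) :
    T^[k] (l • h) = l • T^[k] h := by
  induction k with
  | zero => rfl
  | succ k ih => rw [Function.iterate_succ_apply', ih, hT.2.2 l hl,
      Function.iterate_succ_apply']

lemma ind_nonneg (A : Set X) : 0 ≤ ind A := by
  intro x; classical
  simp only [ind, Set.indicator_apply]; split_ifs <;> simp

lemma ind_le_one (A : Set X) (x : X) : ind A x ≤ 1 := by
  classical
  simp only [ind, Set.indicator_apply]; split_ifs <;> simp

lemma ind_mem {A : Set X} {x : X} (h : x ∈ A) : ind A x = 1 := by simp [ind, h]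
lemma ind_not_mem {A : Set X} {x : X} (h : x ∉ A) : ind A x = 0 := by simp [ind, h]

/-- A function vanishing on all the successors of `x` and with values at most one
has nonpositive upper expectation at `x`. -/
lemma uto_succ (hT : IsUTO T) (x : X) {h : X → ℝ} (h1 : ∀ y, h y ≤ 1)
    (h0 : ∀ y, Edge T x y → h y ≤ 0) : T h x ≤ 0 := by
  classical
  have key : ∀ s : Finset X, (∀ y ∈ s, ¬ Edge T x y) →
      T (∑ y ∈ s, ind {y}) x ≤ 0 := by
    intro s
    induction s using Finset.induction_on with
    | empty => intro _; simp [uto_zero hT]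
    | insert a s ha ih =>
      intro hs
      rw [Finset.sum_insert ha]
      have e1 := hT.2.1 (ind {a}) (∑ y ∈ s, ind {y}) x
      have e2 := ih fun y hy => hs y (Finset.mem_insert_of_mem hy)
      have e3 := not_lt.1 (hs a (Finset.mem_insert_self _ _))
      linarith
  refine le_trans (uto_mono hT ?_ x) (key (Finset.univ.filter fun y => ¬ Edge T x y) (by simp))
  intro y
  rw [Finset.sum_apply]
  by_cases hy : Edge T x y
  · exact (h0 y hy).trans (Finset.sum_nonneg fun i _ => ind_nonneg _ _)
  · refine (h1 y).trans ?_
    have : ind {y} y ≤ ∑ c ∈ Finset.univ.filter fun y => ¬ Edge T x y, ind {c} y :=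
      Finset.single_le_sum (f := fun c => ind {c} y) (fun i _ => ind_nonneg _ _) (by simp [hy])
    rwa [ind_mem (Set.mem_singleton y)] at this

/-- Weak ergodicity forces fixed points to be constant. -/
lemma fixed_of_we (hT : IsUTO T) (hw : WeaklyErgodic T) (u : X → ℝ) (hu : T u = u) :
    ∀ x y, u x = u y := by
  obtain ⟨μ, hμ⟩ := hw u
  have hk : ∀ k : ℕ, (Tf T u)^[k] 0 = (k : ℝ) • u := by
    intro k
    induction k with
    | zero => simp
    | succ k ih =>
      rw [Function.iterate_succ_apply', ih, Tf, hT.2.2 _ (Nat.cast_nonneg k), hu]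
      push_cast
      rw [add_smul, one_smul, add_comm]
  have : ∀ x, u x = μ := by
    intro x
    refine tendsto_nhds_unique ?_ (hμ x)
    refine tendsto_const_nhds.congr' ?_
    filter_upwards [eventually_gt_atTop 0] with k hk0
    have : (k : ℝ) ≠ 0 := by positivity
    rw [hk]
    simp only [Pi.smul_apply, smul_eq_mul]
    field_simp
  intro x y
  rw [this x, this y]

/-- TCA forces fixed points to be constant. -/
lemma fixed_of_tca (hT : IsUTO T) (hw : TCA T) (u : X → ℝ) (hu : T u = u) :
    ∀ x y, u x = u y := by
  obtain ⟨R, ⟨-, hR⟩, hA⟩ := hw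
  obtain ⟨a, ha⟩ := Finite.exists_min u
  obtain ⟨b, hb⟩ := Finite.exists_max u
  set w : X → ℝ := fun y => u y + (-u a) with hw
  have hTw : T w = w := by
    funext x
    rw [hw, uto_add_const hT, hu]
  have hw0 : 0 ≤ w := fun y => by have := ha y; simp only [hw, Pi.zero_apply]; linarith
  have hacc : ∀ y, Acc' T a y → w y = 0 := by
    intro y hy
    induction hy with
    | refl => simp [hw]
    | @tail c d _ hcd ih =>
      have h1 : w d • ind {d} ≤ w := by
        intro z
        by_cases hz : z = d
        · subst hz; simp [ind]
        · have := hw0 z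
          simpa [ind, hz] using this
      have h2 := uto_mono hT h1 c
      rw [hTw, hT.2.2 _ (hw0 d), ih] at h2
      simp only [Pi.smul_apply, smul_eq_mul] at h2
      have h3 := hw0 d
      simp only [Pi.zero_apply] at h3
      unfold Edge at hcd
      by_contra hne
      have : 0 < w d := lt_of_le_of_ne h3 (Ne.symm hne)
      have := mul_pos this hcd
      linarith
  have hwR : ∀ y ∈ R, w y = 0 := fun y hy => hacc y (hR a y hy)
  have hwb : w b = 0 := by
    by_contra hne
    have hbR : b ∉ R := fun h => hne (hwR b h)
    obtain ⟨k, hk⟩ := hA b hbR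
    have hpos : 0 < w b := lt_of_le_of_ne (hw0 b) (Ne.symm hne)
    have h1 : w ≤ w b • ind Rᶜ := by
      intro z
      by_cases hz : z ∈ R
      · simp [hwR z hz, ind, hz]
      · have := hb z
        simp [ind, hz, hw, this]
    have h2 := iter_mono hT k h1 b
    rw [iter_smul hT k hpos.le, Function.iterate_fixed hTw] at h2
    simp only [Pi.smul_apply, smul_eq_mul] at h2
    nlinarith
  have : u b = u a := by simp only [hw] at hwb; linarith
  have hall : ∀ x, u x = u a := fun x => le_antisymm ((hb x).trans this.le) (ha x)
  intro x y
  rw [hall x, hall y]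

lemma we_of_fixed (hT : IsUTO T)
    (hfix : ∀ u : X → ℝ, T u = u → ∀ x y, u x = u y) : WeaklyErgodic T := by
  obtain ⟨x0⟩ := ‹Nonempty X›
  have hcont := uto_cont hT
  obtain ⟨δ, hδ, hδ'⟩ : ∃ δ : ℝ, 0 < δ ∧ ∀ w : X → ℝ, w x0 = 0 → δ * ‖w‖ ≤ ‖T w - w‖ := by
    have hS : IsCompact (Metric.sphere (0 : X → ℝ) 1 ∩ {w | w x0 = 0}) :=
      (isCompact_sphere _ _).inter_right
        (isClosed_eq (continuous_apply x0) continuous_const)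
    obtain ⟨δ, hδ, h⟩ := hS.exists_forall_le' (f := fun w => ‖T w - w‖) (a := 0)
      (by fun_prop) (by
        rintro w ⟨hw1, hw2⟩
        rw [norm_pos_iff, sub_ne_zero]
        intro hw
        have : w = 0 := by
          funext y
          rw [hfix w hw y x0]; exact hw2
        simp [this] at hw1)
    refine ⟨δ, hδ, fun w hw => ?_⟩
    by_cases h0 : w = 0
    · simp [h0]
    have hn : 0 < ‖w‖ := norm_pos_iff.2 h0
    have := h (‖w‖⁻¹ • w) ⟨by simp [norm_smul, hn.ne'], by simp [hw]⟩
    rw [hT.2.2 _ (inv_nonneg.2 hn.le), ← smul_sub, norm_smul, norm_inv, norm_norm] at this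
    calc δ * ‖w‖ ≤ (‖w‖⁻¹ * ‖T w - w‖) * ‖w‖ := by gcongr
      _ = ‖T w - w‖ := by field_simp
  intro f
  set v : ℕ → X → ℝ := fun k => (Tf T f)^[k] 0 with hv
  have hv0 : v 0 = 0 := rfl
  have hvs : ∀ k, v (k+1) = f + T (v k) := fun k => by
    simp only [hv]; rw [Function.iterate_succ_apply']; rfl
  have hstep : ∀ k, ‖v (k+1) - v k‖ ≤ ‖f‖ := by
    intro k
    induction k with
    | zero => simp [hvs, hv0, uto_zero hT]
    | succ k ih =>
      have : v (k+1+1) - v (k+1) = T (v (k+1)) - T (v k) := by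
        rw [hvs (k+1), hvs k]; abel
      rw [this]
      exact (uto_nonexp hT _ _).trans ih
  have hres : ∀ k, ‖T (v k) - v k‖ ≤ 2 * ‖f‖ := by
    intro k
    have : T (v k) - v k = (v (k+1) - v k) - f := by rw [hvs]; abel
    rw [this]
    have h1 := norm_sub_le (v (k+1) - v k) f
    have h2 := hstep k
    linarith
  set C : ℝ := 2 * ‖f‖ / δ with hC
  have hosc : ∀ k x, |v k x - v k x0| ≤ C := by
    intro k x
    have h1 := hδ' (fun y => v k y + (-(v k x0))) (by simp)
    have h2 : T (fun y => v k y + (-(v k x0))) - (fun y => v k y + (-(v k x0)))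
        = T (v k) - v k := by
      funext y
      simp only [Pi.sub_apply]
      rw [uto_add_const hT]; ring
    rw [h2] at h1
    have h3 := norm_le_pi_norm (fun y => v k y + (-(v k x0))) x
    rw [Real.norm_eq_abs, ← sub_eq_add_neg] at h3
    refine h3.trans ?_
    rw [hC, le_div_iff₀ hδ, mul_comm]
    exact h1.trans (hres k)
  have hadd : ∀ m n x, v (m+n) x ≤ v m x + (v n x0 + C) := by
    intro m n
    induction m with
    | zero =>
      intro x
      have := (abs_le.1 (hosc n x)).2
      simp only [zero_add, hv0, Pi.zero_apply]; linarith
    | succ m ih =>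
      intro x
      have e : m + 1 + n = (m + n) + 1 := by ring
      rw [e, hvs, hvs]
      have := uto_mono hT (h := v (m+n)) (g := fun y => v m y + (v n x0 + C)) ih x
      rw [uto_add_const hT] at this
      simp only [Pi.add_apply]; linarith
  have hsub : Subadditive (fun n => v n x0 + C) := by
    intro m n
    have := hadd m n x0
    simp only; linarith
  have hC0 : 0 ≤ C := by positivity
  have hnorm : ∀ n : ℕ, ‖v n‖ ≤ n * ‖f‖ := by
    intro n
    induction n with
    | zero => simp [hv0]
    | succ n ih =>
      have h1 := norm_le_norm_add_norm_sub' (v (n+1)) (v n)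
      have h2 := hstep n
      push_cast
      linarith
  have hbdd : BddBelow (Set.range fun n : ℕ => (v n x0 + C) / n) := by
    refine ⟨-‖f‖, ?_⟩
    rintro _ ⟨n, rfl⟩
    simp only
    rcases Nat.eq_zero_or_pos n with rfl | hn
    · simp
    · have hn' : (0 : ℝ) < n := by exact_mod_cast hn
      rw [le_div_iff₀ hn']
      have h1 := (norm_le_pi_norm (v n) x0).trans (hnorm n)
      rw [Real.norm_eq_abs] at h1
      have := (abs_le.1 h1).1
      linarith
  have hlim := hsub.tendsto_lim hbdd
  refine ⟨hsub.lim, fun x => ?_⟩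
  have hdiff : Tendsto (fun k : ℕ => (v k x - v k x0 - C) / (k : ℝ)) atTop (𝓝 0) := by
    refine squeeze_zero_norm (a := fun k : ℕ => (2 * C) / (k : ℝ)) (fun k => ?_)
      (tendsto_const_div_atTop_nhds_zero_nat _)
    rw [norm_div, Real.norm_natCast, Real.norm_eq_abs]
    gcongr
    have := abs_le.1 (hosc k x)
    rw [abs_le]; constructor <;> linarith [this.1, this.2]
  have := hlim.add hdiff
  rw [add_zero] at this
  refine this.congr fun k => ?_
  simp only [hv]
  ring

lemma tca_of_fixed (hT : IsUTO T)
    (hfix : ∀ u : X → ℝ, T u = u → ∀ x y, u x = u y) : TCA T := by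
  classical
  have hcont := uto_cont hT
  -- limits of iterates are fixed
  have hlimfix : ∀ (g u : X → ℝ), Tendsto (fun k => T^[k] g) atTop (𝓝 u) → T u = u :=
    fun g u h => isFixedPt_of_tendsto_iterate h hcont.continuousAt
  -- closed sets
  have hzero : ∀ S : Set X, (∀ x ∈ S, ∀ y, Edge T x y → y ∈ S) → ∀ h : X → ℝ,
      (∀ y, h y ≤ 1) → (∀ y ∈ S, h y ≤ 0) → ∀ x ∈ S, T h x ≤ 0 := by
    intro S hS h h1 h0 x hx
    exact uto_succ hT x h1 fun y hy => h0 y (hS x hx y hy)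
  have hiter1 : ∀ (A : Set X) (k : ℕ) x, T^[k] (ind A) x ≤ 1 := by
    intro A k
    induction k with
    | zero => exact ind_le_one A
    | succ k ih => intro x; rw [Function.iterate_succ_apply']; exact uto_le hT ih x
  have hiter0 : ∀ (A : Set X) (k : ℕ), 0 ≤ T^[k] (ind A) := by
    intro A k
    induction k with
    | zero => exact ind_nonneg A
    | succ k ih => rw [Function.iterate_succ_apply']; exact uto_nonneg hT ih
  have hiterS : ∀ S : Set X, (∀ x ∈ S, ∀ y, Edge T x y → y ∈ S) → ∀ A : Set X,
      Disjoint A S → ∀ (k : ℕ), ∀ x ∈ S, T^[k] (ind A) x ≤ 0 := by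
    intro S hS A hA k
    induction k with
    | zero => intro x hx; exact (ind_not_mem (fun h => Set.disjoint_left.1 hA h hx)).le
    | succ k ih =>
      rw [Function.iterate_succ_apply']
      exact hzero S hS _ (hiter1 A k) ih
  obtain ⟨x0, hx0⟩ := Finite.exists_min fun x : X => Set.ncard {y | Acc' T x y}
  set R : Set X := {y | Acc' T x0 y} with hR
  have hRcl : ∀ x ∈ R, ∀ y, Edge T x y → y ∈ R := fun x hx y hxy => hx.tail hxy
  have hback : ∀ y ∈ R, Acc' T y x0 := by
    intro y hy
    have hss : {z | Acc' T y z} ⊆ R := fun z hz => Relation.ReflTransGen.trans hy hz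
    have := Set.eq_of_subset_of_ncard_le hss (hx0 y) (Set.toFinite _)
    have hx : x0 ∈ R := Relation.ReflTransGen.refl
    rw [← this] at hx
    exact hx
  have hx0R : x0 ∈ R := Relation.ReflTransGen.refl
  -- monotone/antitone bounded iterates converge
  have htop : ∀ z, Acc' T z x0 := by
    intro z
    by_contra hz
    set Q : Set X := {y | Acc' T z y} with hQ
    have hQcl : ∀ x ∈ Q, ∀ y, Edge T x y → y ∈ Q := fun x hx y hxy => hx.tail hxy
    have hdisj : Disjoint R Q := Set.disjoint_left.2 fun w hw hw' =>
      hz (Relation.ReflTransGen.trans hw' (hback w hw))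
    have hle : ind R ≤ T (ind R) := by
      intro x
      by_cases hx : x ∈ R
      · rw [ind_mem hx]
        have h1 := hzero R hRcl (fun y => 1 - ind R y)
          (fun y => by have := ind_nonneg R y; simp only [Pi.zero_apply] at this; linarith)
          (fun y hy => by rw [ind_mem hy]; simp) x hx
        have h2 := hT.2.1 (ind R) (fun y => 1 - ind R y) x
        have h3 : (ind R + fun y => 1 - ind R y) = fun y => (0 : X → ℝ) y + 1 := by
          funext y; simp
        rw [h3, uto_add_const hT, uto_zero hT] at h2
        simp only [Pi.zero_apply] at h2
        linarith
      · rw [ind_not_mem hx]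
        exact uto_nonneg hT (ind_nonneg R) x
    have hmono : Monotone fun k => T^[k] (ind R) := by
      refine monotone_nat_of_le_succ fun k => ?_
      rw [Function.iterate_succ_apply]
      exact iter_mono hT k hle
    have hconv : Tendsto (fun k => T^[k] (ind R)) atTop (𝓝 fun x => ⨆ k, T^[k] (ind R) x) := by
      rw [tendsto_pi_nhds]
      intro x
      exact tendsto_atTop_ciSup (fun i j hij => hmono hij x)
        ⟨1, by rintro _ ⟨k, rfl⟩; exact hiter1 R k x⟩
    have hf := hfix _ (hlimfix _ _ hconv) z x0
    have h1 := tendsto_pi_nhds.1 hconv x0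
    have h2 := tendsto_pi_nhds.1 hconv z
    have h3 := ge_of_tendsto' h1 (b := 1) (fun k => by
      have := hmono (Nat.zero_le k) x0
      simpa [ind_mem hx0R] using this)
    have h4 := le_of_tendsto' h2 (b := 0) (fun k =>
      hiterS Q hQcl R hdisj k z Relation.ReflTransGen.refl)
    linarith
  refine ⟨R, ⟨⟨x0, ?_⟩, fun x y hy => Relation.ReflTransGen.trans (htop x) hy⟩, ?_⟩
  · ext y
    exact ⟨fun hy => ⟨hy, hback y hy⟩, fun hy => hy.1⟩
  · intro x hx
    by_contra! hk
    have hle : T (ind Rᶜ) ≤ ind Rᶜ := by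
      intro y
      by_cases hy : y ∈ R
      · rw [ind_not_mem (by simpa using hy)]
        exact hiterS R hRcl Rᶜ disjoint_compl_left 1 y hy
      · rw [ind_mem (by simpa using hy)]
        exact hiter1 Rᶜ 1 y
    have hanti : Antitone fun k => T^[k] (ind Rᶜ) := by
      refine antitone_nat_of_succ_le fun k => ?_
      rw [Function.iterate_succ_apply]
      exact iter_mono hT k hle
    have hconv : Tendsto (fun k => T^[k] (ind Rᶜ)) atTop
        (𝓝 fun x => ⨅ k, T^[k] (ind Rᶜ) x) := by
      rw [tendsto_pi_nhds]
      intro x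
      exact tendsto_atTop_ciInf (fun i j hij => hanti hij x)
        ⟨0, by rintro _ ⟨k, rfl⟩; exact hiter0 Rᶜ k x⟩
    have hf := hfix _ (hlimfix _ _ hconv) x x0
    have h1 := tendsto_pi_nhds.1 hconv x0
    have h2 := tendsto_pi_nhds.1 hconv x
    have h3 := ge_of_tendsto' h2 (b := 1) hk
    have h4 := le_of_tendsto' h1 (b := 0) (fun k =>
      hiterS R hRcl Rᶜ disjoint_compl_left k x0 hx0R)
    linarith

end aux

/-- An upper transition operator `T̄` is weakly ergodic
if and only if it satisfies (TCA). -/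
theorem weaklyErgodic_iff_TCA {X : Type*} [Fintype X] [Nonempty X]
    (T : (X → ℝ) → (X → ℝ)) (hT : IsUTO T) :
    WeaklyErgodic T ↔ TCA T :=
  ⟨fun h => tca_of_fixed hT (fixed_of_we hT h), fun h => we_of_fixed hT (fixed_of_tca hT h)⟩

end WeakErg
end

section
/- Let 𝒯 be a nonempty, separately specified set of transition matrices on X and let T̄ be its upper envelope. Then the imprecise Markov chain under repetition independence associated with 𝒯 is weakly ergodic if and only if T̄ satisfies (TCA). Moreover, in that case, for every f ∈ ℒ(X) and every x ∈ X the limits lim_{k→∞} sup_{T∈𝒯} (1/k)·[T_f^k(0)](x) and lim_{k→∞} (1/k)·[T̄_f^k(0)](x) both exist and are equal. -/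
open Filter Topology

namespace WeakErg

section helpers
set_option linter.unusedSectionVars false
variable {X : Type*} [Fintype X] [Nonempty X]

theorem app_mono (T : TransMat X) {h g : X → ℝ} (hg : ∀ y, h y ≤ g y) (x : X) :
    T.apply h x ≤ T.apply g x :=
  Finset.sum_le_sum fun y _ => mul_le_mul_of_nonneg_left (hg y) (T.nonneg x y)

theorem app_aff (T : TransMat X) (c m : ℝ) (h : X → ℝ) (x : X) :
    T.apply (fun y => c + m * h y) x = c + m * T.apply h x := by
  unfold TransMat.apply
  simp only [mul_add, Finset.sum_add_distrib, Finset.mul_sum]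
  rw [← Finset.sum_mul, T.rowSum, one_mul]
  congr 1
  exact Finset.sum_congr rfl fun y _ => by ring

theorem app_const (T : TransMat X) (c : ℝ) (x : X) : T.apply (fun _ => c) x = c := by
  unfold TransMat.apply
  rw [← Finset.sum_mul, T.rowSum, one_mul]

theorem app_ind (T : TransMat X) (x y : X) : T.apply (ind {y}) x = T.P x y := by
  classical
  unfold TransMat.apply ind
  rw [Finset.sum_eq_single y]
  · simp
  · intro b _ hb
    simp [hb]
  · simp

theorem le_nrm (h : X → ℝ) (y : X) : h y ≤ ‖h‖ :=
  (le_abs_self _).trans (norm_le_pi_norm h y)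

theorem neg_nrm_le (h : X → ℝ) (y : X) : -‖h‖ ≤ h y :=
  (neg_le_neg (norm_le_pi_norm h y)).trans (neg_abs_le _)

theorem app_le_nrm (T : TransMat X) (h : X → ℝ) (x : X) : T.apply h x ≤ ‖h‖ := by
  have := app_mono T (g := fun _ => ‖h‖) (le_nrm h) x
  rwa [app_const] at this

variable {𝒯 : Set (TransMat X)} {Tbar : (X → ℝ) → (X → ℝ)}

theorem env_ge (henv : IsUpperEnv 𝒯 Tbar) {T : TransMat X} (hT : T ∈ 𝒯) (h : X → ℝ) (x : X) :
    T.apply h x ≤ Tbar h x := by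
  rw [henv]
  refine le_ciSup (f := fun T : 𝒯 => TransMat.apply T.1 h x) ?_ ⟨T, hT⟩
  refine ⟨‖h‖, ?_⟩
  rintro _ ⟨S, rfl⟩
  exact app_le_nrm _ _ _

theorem env_le (hne : 𝒯.Nonempty) (henv : IsUpperEnv 𝒯 Tbar) (h : X → ℝ) (x : X) (c : ℝ)
    (H : ∀ T ∈ 𝒯, T.apply h x ≤ c) : Tbar h x ≤ c := by
  rw [henv]
  have := hne.to_subtype
  exact ciSup_le fun T => H T.1 T.2

theorem env_mono (hne : 𝒯.Nonempty) (henv : IsUpperEnv 𝒯 Tbar) : Monotone Tbar := by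
  intro h g hg x
  exact env_le hne henv _ _ _ fun T hT => (app_mono T hg x).trans (env_ge henv hT g x)

theorem env_aff (hne : 𝒯.Nonempty) (henv : IsUpperEnv 𝒯 Tbar) (c m : ℝ) (hm : 0 ≤ m)
    (h : X → ℝ) : Tbar (fun y => c + m * h y) = fun x => c + m * Tbar h x := by
  funext x
  apply le_antisymm
  · refine env_le hne henv _ _ _ fun T hT => ?_
    rw [app_aff]
    have := mul_le_mul_of_nonneg_left (env_ge henv hT h x) hm
    linarith
  · rcases hm.eq_or_lt with rfl | hm
    · obtain ⟨T, hT⟩ := hne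
      have := env_ge henv hT (fun y => c + 0 * h y) x
      rw [app_aff] at this
      linarith
    · have : Tbar h x ≤ (Tbar (fun y => c + m * h y) x - c) / m := by
        refine env_le hne henv _ _ _ fun T hT => ?_
        have := env_ge henv hT (fun y => c + m * h y) x
        rw [app_aff] at this
        rw [le_div_iff₀ hm]
        linarith
      rw [le_div_iff₀ hm] at this
      linarith

theorem env_const (hne : 𝒯.Nonempty) (henv : IsUpperEnv 𝒯 Tbar) (c : ℝ) (x : X) :
    Tbar (fun _ => c) x = c := by
  have := congrFun (env_aff hne henv c 0 le_rfl (fun _ => 0)) x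
  simpa using this

theorem env_add (hne : 𝒯.Nonempty) (henv : IsUpperEnv 𝒯 Tbar) (c : ℝ) (h : X → ℝ) (x : X) :
    Tbar (fun y => c + h y) x = c + Tbar h x := by
  have := congrFun (env_aff hne henv c 1 zero_le_one h) x
  simpa using this

theorem env_opt (hne : 𝒯.Nonempty) (hsep : SepSpec 𝒯) (henv : IsUpperEnv 𝒯 Tbar) (h : X → ℝ)
    (ε : ℝ) (hε : 0 < ε) : ∃ T ∈ 𝒯, ∀ x, Tbar h x - ε ≤ T.apply h x := by
  classical
  have h1 : ∀ x, ∃ T ∈ 𝒯, Tbar h x - ε ≤ T.apply h x := by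
    intro x
    by_contra hcon
    push Not at hcon
    have := env_le hne henv h x _ fun T hT => (hcon T hT).le
    linarith
  choose S hS hS' using h1
  have h2 : ∀ s : Finset X, ∃ T ∈ 𝒯, ∀ x ∈ s, T.P x = (S x).P x := by
    intro s
    induction s using Finset.induction_on with
    | empty =>
      obtain ⟨T, hT⟩ := hne
      exact ⟨T, hT, by simp⟩
    | insert a s ha ih =>
      obtain ⟨T, hT, hTs⟩ := ih
      obtain ⟨U, hU, hU1, hU2⟩ := hsep (S a) (hS a) T hT {a}
      refine ⟨U, hU, ?_⟩
      intro x hx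
      by_cases hxa : x = a
      · subst hxa
        exact hU1 x rfl
      · rw [hU2 x hxa]
        exact hTs x ((Finset.mem_insert.1 hx).resolve_left hxa)
  obtain ⟨T, hT, hTs⟩ := h2 Finset.univ
  refine ⟨T, hT, fun x => (hS' x).trans_eq ?_⟩
  unfold TransMat.apply
  rw [hTs x (Finset.mem_univ x)]

theorem env_lip (hne : 𝒯.Nonempty) (henv : IsUpperEnv 𝒯 Tbar) (h g : X → ℝ) (x : X) :
    |Tbar h x - Tbar g x| ≤ dist h g := by
  have key : ∀ h g : X → ℝ, Tbar h x ≤ dist h g + Tbar g x := by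
    intro h g
    rw [← env_add hne henv]
    refine env_mono hne henv ?_ x
    intro y
    have := dist_le_pi_dist h g y
    rw [Real.dist_eq] at this
    have := (le_abs_self _).trans this
    show h y ≤ dist h g + g y
    linarith
  have h1 := key h g
  have h2 := key g h
  rw [dist_comm] at h2
  rw [abs_le]
  constructor <;> linarith

theorem env_cont (hne : 𝒯.Nonempty) (henv : IsUpperEnv 𝒯 Tbar) (x : X) :
    Continuous fun h => Tbar h x := by
  refine (LipschitzWith.of_dist_le_mul (K := 1) fun h g => ?_).continuous
  rw [Real.dist_eq]
  simpa using env_lip hne henv h g x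

theorem P_zero (henv : IsUpperEnv 𝒯 Tbar) {T : TransMat X} (hT : T ∈ 𝒯) {x y : X}
    (h : ¬ Edge Tbar x y) : T.P x y = 0 := by
  have := env_ge henv hT (ind {y}) x
  rw [app_ind] at this
  unfold Edge at h
  exact le_antisymm (by linarith) (T.nonneg x y)

/-- discounted fixed point -/
theorem disc_fix (hne : 𝒯.Nonempty) (henv : IsUpperEnv 𝒯 Tbar) (f : X → ℝ) (a : ℝ)
    (ha0 : 0 ≤ a) (ha1 : a < 1) : ∃ h : X → ℝ, ∀ x, f x + a * Tbar h x = h x := by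
  have hc : ContractingWith ⟨a, ha0⟩ (fun h : X → ℝ => fun x => f x + a * Tbar h x) := by
    refine ⟨ha1, LipschitzWith.of_dist_le_mul fun h g => ?_⟩
    rw [dist_pi_le_iff (by positivity)]
    intro x
    rw [Real.dist_eq]
    have : f x + a * Tbar h x - (f x + a * Tbar g x) = a * (Tbar h x - Tbar g x) := by ring
    rw [this, abs_mul, abs_of_nonneg ha0]
    exact mul_le_mul_of_nonneg_left (env_lip hne henv h g x) ha0
  exact ⟨_, congrFun hc.fixedPoint_isFixedPt⟩

def QQ (Tbar : (X → ℝ) → (X → ℝ)) (D : ℝ) (g : X → ℝ) : Prop :=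
  (∀ x, 0 ≤ g x) ∧ (∀ x, g x ≤ D + Tbar g x) ∧ (∀ x, (1/2) * Tbar g x ≤ g x + D) ∧ ∃ z, g z = 0

theorem path_bound (hne : 𝒯.Nonempty) (henv : IsUpperEnv 𝒯 Tbar) (D : ℝ) (z y : X)
    (hzy : Acc' Tbar z y) : ∃ C : ℝ, ∀ g, QQ Tbar D g → g z = 0 → g y ≤ C := by
  unfold Acc' at hzy
  induction hzy with
  | refl => exact ⟨0, fun g _ h => h.le⟩
  | @tail w y _ hwy ih =>
    obtain ⟨C, hC⟩ := ih
    refine ⟨2 * (C + D) / Tbar (ind {y}) w, fun g hg hz => ?_⟩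
    rw [le_div_iff₀ hwy]
    have h1 := hC g hg hz
    have h2 := hg.2.2.1 w
    have h3 := congrFun (env_aff hne henv 0 (g y) (hg.1 y) (ind {y})) w
    have h4 : Tbar (fun v => 0 + g y * ind {y} v) w ≤ Tbar g w := by
      refine env_mono hne henv ?_ w
      intro v
      by_cases hv : v = y
      · subst hv; simp [ind]
      · simp [ind, hv, hg.1 v]
    linarith

theorem top_closed {R : Set X} (hR : IsTopClass Tbar R) {x y : X} (hx : x ∈ R)
    (hxy : Edge Tbar x y) : y ∈ R := by
  obtain ⟨⟨x0, rfl⟩, htop⟩ := hR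
  exact ⟨hx.1.tail hxy, htop y x0 ⟨.refl, .refl⟩⟩

theorem iter_aff (hne : 𝒯.Nonempty) (henv : IsUpperEnv 𝒯 Tbar) (c m : ℝ) (hm : 0 ≤ m)
    (h : X → ℝ) (k : ℕ) : Tbar^[k] (fun y => c + m * h y) = fun x => c + m * Tbar^[k] h x := by
  induction k with
  | zero => rfl
  | succ k ih => rw [Function.iterate_succ_apply', ih, env_aff hne henv _ _ hm,
      Function.iterate_succ_apply']

theorem ind_le (hne : 𝒯.Nonempty) (henv : IsUpperEnv 𝒯 Tbar) {R : Set X}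
    (hR : ∀ x ∈ R, ∀ y, Edge Tbar x y → y ∈ R) : Tbar (ind Rᶜ) ≤ ind Rᶜ := by
  intro x
  by_cases hx : x ∈ R
  · have : ind Rᶜ x = 0 := by simp [ind, hx]
    rw [this]
    refine env_le hne henv _ _ _ fun T hT => ?_
    refine Finset.sum_nonpos fun y _ => ?_
    by_cases hy : y ∈ R
    · simp [ind, hy]
    · rw [P_zero henv hT (fun h => hy (hR x hx y h)), zero_mul]
  · have : ind Rᶜ x = 1 := by simp [ind, hx]
    rw [this, ← env_const hne henv 1 x]
    refine env_mono hne henv ?_ x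
    intro y
    by_cases hy : y ∈ R <;> simp [ind, hy]

theorem phi_anti (hne : 𝒯.Nonempty) (henv : IsUpperEnv 𝒯 Tbar) {R : Set X}
    (hR : ∀ x ∈ R, ∀ y, Edge Tbar x y → y ∈ R) :
    Antitone fun k : ℕ => Tbar^[k] (ind Rᶜ) :=
  (env_mono hne henv).antitone_iterate_of_map_le (ind_le hne henv hR)

theorem span_bound (hne : 𝒯.Nonempty) (henv : IsUpperEnv 𝒯 Tbar) (hTCA : TCA Tbar) (D : ℝ) :
    ∃ C : ℝ, ∀ g, QQ Tbar D g → ∀ x, g x ≤ C := by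
  obtain ⟨R, hR, habs⟩ := hTCA
  have h1 : ∀ p : X × X, ∃ C : ℝ, p.2 ∈ R → ∀ g, QQ Tbar D g → g p.1 = 0 → g p.2 ≤ C := by
    intro p
    by_cases hp : p.2 ∈ R
    · obtain ⟨C, hC⟩ := path_bound hne henv D p.1 p.2 (hR.2 _ _ hp)
      exact ⟨C, fun _ => hC⟩
    · exact ⟨0, fun h => absurd h hp⟩
  choose C1 hC1 using h1
  obtain ⟨C, hC⟩ := Finite.exists_le C1
  have hcl : ∀ x ∈ R, ∀ y, Edge Tbar x y → y ∈ R := fun x hx y h => top_closed hR hx h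
  have hanti := phi_anti hne henv hcl
  have h2 : ∀ x, ∃ k : ℕ, Tbar^[k] (ind Rᶜ) x < 1 := by
    intro x
    by_cases hx : x ∈ R
    · exact ⟨0, by simp [ind, hx]⟩
    · exact habs x hx
  choose k hk using h2
  obtain ⟨K, hK⟩ := Finite.exists_le k
  obtain ⟨w, hw⟩ := Finite.exists_max fun x => Tbar^[K] (ind Rᶜ) x
  set q := Tbar^[K] (ind Rᶜ) w with hq
  have hq1 : q < 1 := (hanti (hK w) w).trans_lt (hk w)
  refine ⟨(K * D + C) / (1 - q), fun g hg x => ?_⟩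
  have hiter : ∀ n : ℕ, ∀ x, g x ≤ n * D + Tbar^[n] g x := by
    intro n
    induction n with
    | zero => intro x; simp
    | succ n ih =>
      intro x
      have a1 := hg.2.1 x
      have a2 := env_mono hne henv (b := fun x => n * D + Tbar^[n] g x) ih x
      rw [env_add hne henv] at a2
      rw [Function.iterate_succ_apply']
      push_cast
      linarith
  obtain ⟨v, hv⟩ := Finite.exists_max g
  obtain ⟨z, hz⟩ := hg.2.2.2
  have hCR : ∀ y ∈ R, g y ≤ C := fun y hy => (hC1 (z, y) hy g hg hz).trans (hC (z, y))
  have hC0 : 0 ≤ C := by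
    obtain ⟨⟨x0, hx0⟩, _⟩ := hR
    have : x0 ∈ R := by rw [hx0]; exact ⟨.refl, .refl⟩
    exact (hg.1 x0).trans (hCR x0 this)
  have b1 : Tbar^[K] g v ≤ C + g v * q := by
    have : g ≤ fun y => C + g v * ind Rᶜ y := by
      intro y
      by_cases hy : y ∈ R
      · simpa [ind, hy] using hCR y hy
      · simp [ind, hy]; linarith [hv y]
    have := (env_mono hne henv).iterate K this v
    rw [iter_aff hne henv _ _ (hg.1 v)] at this
    have h3 := mul_le_mul_of_nonneg_left (hw v) (hg.1 v)
    simp only at this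
    linarith
  have b2 := hiter K v
  refine (hv x).trans ?_
  rw [le_div_iff₀ (by linarith)]
  linarith

theorem approx_eig (hne : 𝒯.Nonempty) (henv : IsUpperEnv 𝒯 Tbar) (f : X → ℝ) (C : ℝ)
    (hC : ∀ g, QQ Tbar (2 * ‖f‖) g → ∀ x, g x ≤ C) (a : ℝ) (ha0 : 1/2 ≤ a) (ha1 : a < 1) :
    ∃ (g : X → ℝ) (μ : ℝ), (∀ x, 0 ≤ g x ∧ g x ≤ C) ∧ (-‖f‖ ≤ μ ∧ μ ≤ ‖f‖) ∧
      ∀ x, g x + μ ≤ f x + Tbar g x ∧ f x + Tbar g x ≤ g x + μ + (1 - a) * C := by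
  obtain ⟨h, hh⟩ := disc_fix hne henv f a (by linarith) ha1
  obtain ⟨z, hz⟩ := Finite.exists_min h
  obtain ⟨w, hw⟩ := Finite.exists_max h
  have hlo : ∀ x, h z ≤ Tbar h x := fun x => by
    rw [← env_const hne henv (h z) x]; exact env_mono hne henv hz x
  have hhi : ∀ x, Tbar h x ≤ h w := fun x => by
    rw [← env_const hne henv (h w) x]; exact env_mono hne henv hw x
  have m1 : -‖f‖ ≤ (1 - a) * h z := by
    have := mul_le_mul_of_nonneg_left (hlo z) (by linarith : 0 ≤ a)
    linarith [hh z, neg_nrm_le f z]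
  have m2 : (1 - a) * h z ≤ ‖f‖ := by
    have := mul_le_mul_of_nonneg_left (hhi w) (by linarith : 0 ≤ a)
    have := mul_le_mul_of_nonneg_left (hz w) (by linarith : 0 ≤ 1 - a)
    linarith [hh w, le_nrm f w]
  set g : X → ℝ := fun y => -h z + h y with hg
  have hTg : ∀ x, Tbar g x = -h z + Tbar h x := fun x => env_add hne henv _ _ x
  have hTg0 : ∀ x, 0 ≤ Tbar g x := fun x => by rw [hTg]; linarith [hlo x]
  have hge : ∀ x, g x = f x - (1 - a) * h z + a * Tbar g x := fun x => by
    rw [hTg]; simp only [hg]; linarith [hh x]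
  have hQ : QQ Tbar (2 * ‖f‖) g := by
    refine ⟨fun x => by simp only [hg]; linarith [hz x], fun x => ?_, fun x => ?_,
      z, by simp [hg]⟩
    · have := mul_le_mul_of_nonneg_right ha1.le (hTg0 x)
      linarith [hge x, le_nrm f x]
    · have := mul_le_mul_of_nonneg_right ha0 (hTg0 x)
      linarith [hge x, neg_nrm_le f x]
  have hgC := hC g hQ
  have hTgC : ∀ x, Tbar g x ≤ C := fun x => by
    rw [← env_const hne henv C x]; exact env_mono hne henv hgC x
  refine ⟨g, (1 - a) * h z, fun x => ⟨hQ.1 x, hgC x⟩, ⟨m1, m2⟩, fun x => ⟨?_, ?_⟩⟩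
  · have := mul_nonneg (by linarith : 0 ≤ 1 - a) (hTg0 x)
    linarith [hge x]
  · have := mul_le_mul_of_nonneg_left (hTgC x) (by linarith : 0 ≤ 1 - a)
    linarith [hge x]

theorem eig (hne : 𝒯.Nonempty) (henv : IsUpperEnv 𝒯 Tbar) (hTCA : TCA Tbar) (f : X → ℝ) :
    ∃ (g : X → ℝ) (μ : ℝ), ∀ x, f x + Tbar g x = g x + μ := by
  obtain ⟨C, hC⟩ := span_bound hne henv hTCA (2 * ‖f‖)
  have hsm : ∀ n : ℕ, 0 < 1 / ((n : ℝ) + 1) ∧ 1 / ((n : ℝ) + 1) ≤ 1 := fun n =>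
    ⟨by positivity, by rw [div_le_one (by positivity)]; linarith [n.cast_nonneg (α := ℝ)]⟩
  have := fun n : ℕ => approx_eig hne henv f C hC (1 - 1 / ((n : ℝ) + 1) / 2)
    (by linarith [hsm n]) (by linarith [hsm n])
  choose g μ hg hμ hgμ using this
  have hcpt : IsCompact (Set.Icc ((fun _ => 0 : X → ℝ), -‖f‖) ((fun _ => C : X → ℝ), ‖f‖)) :=
    isCompact_Icc
  obtain ⟨⟨G, M⟩, -, φ, hφ, hlim⟩ := hcpt.tendsto_subseq (x := fun n => (g n, μ n))
    (fun n => ⟨⟨fun x => (hg n x).1, (hμ n).1⟩, ⟨fun x => (hg n x).2, (hμ n).2⟩⟩)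
  have l1 : Tendsto (fun n => g (φ n)) atTop (𝓝 G) := (continuous_fst.tendsto _).comp hlim
  have l2 : Tendsto (fun n => μ (φ n)) atTop (𝓝 M) := (continuous_snd.tendsto _).comp hlim
  refine ⟨G, M, fun x => ?_⟩
  have l3 : Tendsto (fun n => g (φ n) x) atTop (𝓝 (G x)) := ((continuous_apply x).tendsto _).comp l1
  have l4 : Tendsto (fun n => Tbar (g (φ n)) x) atTop (𝓝 (Tbar G x)) :=
    ((env_cont hne henv x).tendsto _).comp l1
  have l5 : Tendsto (fun n => 1 / ((φ n : ℝ) + 1)) atTop (𝓝 0) :=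
    tendsto_one_div_add_atTop_nhds_zero_nat.comp hφ.tendsto_atTop
  have l6 := ((l3.add l2).add (((l5.div_const 2)).mul_const C))
  apply le_antisymm
  · have := le_of_tendsto_of_tendsto' (l4.const_add (f x)) l6 fun n => by
      have := (hgμ (φ n) x).2
      linarith
    linarith
  · exact le_of_tendsto_of_tendsto' (l3.add l2) (l4.const_add (f x)) fun n => (hgμ (φ n) x).1

theorem Tf_mono {T : (X → ℝ) → (X → ℝ)} (hT : Monotone T) (f : X → ℝ) : Monotone (Tf T f) :=
  fun _ _ h => by unfold Tf; exact add_le_add_right (hT h) f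

theorem Tf_iter_le {T : (X → ℝ) → (X → ℝ)} (hT : Monotone T)
    (hc : ∀ c h x, T (fun y => c + h y) x = c + T h x) (f g : X → ℝ) (μ c : ℝ)
    (h0 : ∀ x, 0 ≤ c + g x) (hg : ∀ x, f x + T g x ≤ g x + μ) (k : ℕ) (x : X) :
    (Tf T f)^[k] 0 x ≤ (k * μ + c) + g x := by
  induction k generalizing x with
  | zero => simpa using h0 x
  | succ k ih =>
    rw [Function.iterate_succ_apply']
    have := hT (b := fun x => (k * μ + c) + g x) ih x
    rw [hc] at this
    have h2 := hg x
    show f x + T _ x ≤ _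
    push_cast
    linarith

theorem Tf_le_iter {T : (X → ℝ) → (X → ℝ)} (hT : Monotone T)
    (hc : ∀ c h x, T (fun y => c + h y) x = c + T h x) (f g : X → ℝ) (μ c : ℝ)
    (h0 : ∀ x, c + g x ≤ 0) (hg : ∀ x, g x + μ ≤ f x + T g x) (k : ℕ) (x : X) :
    (k * μ + c) + g x ≤ (Tf T f)^[k] 0 x := by
  induction k generalizing x with
  | zero => simpa using h0 x
  | succ k ih =>
    rw [Function.iterate_succ_apply']
    have := hT (a := fun x => (k * μ + c) + g x) ih x
    rw [hc] at this
    have h2 := hg x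
    show _ ≤ f x + T _ x
    push_cast
    linarith

theorem app_monotone (T : TransMat X) : Monotone T.apply := fun _ _ h x => app_mono T h x

theorem app_add (T : TransMat X) (c : ℝ) (h : X → ℝ) (x : X) :
    T.apply (fun y => c + h y) x = c + T.apply h x := by
  simpa using app_aff T c 1 h x

theorem ri_bdd (𝒯 : Set (TransMat X)) (f : X → ℝ) (x : X) (k : ℕ) :
    BddAbove (Set.range fun T : 𝒯 => (1 / (k : ℝ)) * (Tf (TransMat.apply T.1) f)^[k] 0 x) := by
  refine ⟨(1 / (k : ℝ)) * ((k * ‖f‖ + 0) + 0), ?_⟩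
  rintro _ ⟨T, rfl⟩
  refine mul_le_mul_of_nonneg_left ?_ (by positivity)
  exact Tf_iter_le (app_monotone T.1) (app_add T.1) f (fun _ => 0) ‖f‖ 0 (by simp)
    (fun x => by rw [app_const]; linarith [le_nrm f x]) k x

theorem lim_of_bounds (u : ℕ → ℝ) (μ c : ℝ)
    (h1 : ∀ k : ℕ, 0 < k → u k ≤ μ + c / k)
    (h2 : ∀ ε > 0, ∀ k : ℕ, 0 < k → μ - ε - c / k ≤ u k) : Tendsto u atTop (𝓝 μ) := by
  have h2' : ∀ k : ℕ, 0 < k → μ - c / k ≤ u k := fun k hk =>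
    le_of_forall_pos_le_add fun ε hε => by linarith [h2 ε hε k hk]
  have l := tendsto_const_div_atTop_nhds_zero_nat c
  have l1 : Tendsto (fun k : ℕ => μ + c / k) atTop (𝓝 μ) := by simpa using l.const_add μ
  have l2 : Tendsto (fun k : ℕ => μ - c / k) atTop (𝓝 μ) := by simpa using l.const_sub μ
  refine tendsto_of_tendsto_of_tendsto_of_le_of_le' l2 l1 ?_ ?_
  · filter_upwards [eventually_gt_atTop 0] with k hk using h2' k hk
  · filter_upwards [eventually_gt_atTop 0] with k hk using h1 k hk

theorem part1 (hne : 𝒯.Nonempty) (hsep : SepSpec 𝒯) (henv : IsUpperEnv 𝒯 Tbar)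
    (hTCA : TCA Tbar) (f : X → ℝ) : ∃ μ : ℝ, ∀ x : X,
      Tendsto (riSeq 𝒯 f x) atTop (𝓝 μ) ∧
      Tendsto (fun k : ℕ => (1 / (k : ℝ)) * (Tf Tbar f)^[k] 0 x) atTop (𝓝 μ) := by
  obtain ⟨g, μ, hg⟩ := eig hne henv hTCA f
  have hn1 := le_nrm g
  have hn2 := neg_nrm_le g
  have dv : ∀ k : ℕ, 0 < k → ∀ a b : ℝ, (1 / (k : ℝ)) * (k * a + b) = a + b / k := by
    intro k hk a b
    have : (k : ℝ) ≠ 0 := by positivity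
    field_simp
  have up : ∀ (k : ℕ) (x : X), (Tf Tbar f)^[k] 0 x ≤ k * μ + 2 * ‖g‖ := fun k x => by
    have := Tf_iter_le (env_mono hne henv) (env_add hne henv) f g μ ‖g‖
      (fun x => by linarith [hn2 x]) (fun x => (hg x).le) k x
    linarith [hn1 x]
  have lo : ∀ (k : ℕ) (x : X), k * μ + (-(2 * ‖g‖)) ≤ (Tf Tbar f)^[k] 0 x := fun k x => by
    have := Tf_le_iter (env_mono hne henv) (env_add hne henv) f g μ (-‖g‖)
      (fun x => by linarith [hn1 x]) (fun x => (hg x).ge) k x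
    linarith [hn2 x]
  have up' : ∀ k : ℕ, 0 < k → ∀ x, (1 / (k : ℝ)) * (Tf Tbar f)^[k] 0 x ≤ μ + 2 * ‖g‖ / k := by
    intro k hk x
    rw [← dv k hk]
    exact mul_le_mul_of_nonneg_left (up k x) (by positivity)
  refine ⟨μ, fun x => ⟨?_, ?_⟩⟩
  · refine lim_of_bounds _ μ (2 * ‖g‖) (fun k hk => ?_) (fun ε hε k hk => ?_)
    · have := hne.to_subtype
      refine ciSup_le fun T => ?_
      refine le_trans ?_ (up' k hk x)
      refine mul_le_mul_of_nonneg_left ?_ (by positivity)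
      have : ∀ n : ℕ, (Tf (TransMat.apply T.1) f)^[n] 0 ≤ (Tf Tbar f)^[n] 0 := by
        intro n
        induction n with
        | zero => exact le_rfl
        | succ n ih =>
          rw [Function.iterate_succ_apply', Function.iterate_succ_apply']
          refine le_trans ?_ (Tf_mono (env_mono hne henv) f ih)
          exact fun y => by
            have := env_ge henv T.2 ((Tf (TransMat.apply T.1) f)^[n] 0) y
            show f y + _ ≤ f y + _
            linarith
      exact this k x
    · obtain ⟨T, hT, hTo⟩ := env_opt hne hsep henv g ε hε
      refine le_trans ?_ (le_ciSup (ri_bdd 𝒯 f x k) ⟨T, hT⟩)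
      have h1 := Tf_le_iter (app_monotone T) (app_add T) f g (μ - ε) (-‖g‖)
        (fun x => by linarith [hn1 x]) (fun x => by linarith [hg x, hTo x]) k x
      have h2 : k * (μ - ε) + (-(2 * ‖g‖)) ≤ (Tf T.apply f)^[k] 0 x := by linarith [hn2 x]
      have h3 := mul_le_mul_of_nonneg_left h2 (by positivity : 0 ≤ 1 / (k : ℝ))
      rw [dv k hk, neg_div, ← sub_eq_add_neg] at h3
      exact h3
  · refine lim_of_bounds _ μ (2 * ‖g‖) (fun k hk => up' k hk x) (fun ε hε k hk => ?_)
    have h3 := mul_le_mul_of_nonneg_left (lo k x) (by positivity : 0 ≤ 1 / (k : ℝ))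
    rw [dv k hk, neg_div] at h3
    linarith

theorem closed_iter (henv : IsUpperEnv 𝒯 Tbar) {S : Set X}
    (hS : ∀ x ∈ S, ∀ y, Edge Tbar x y → y ∈ S) (f : X → ℝ) (c : ℝ) (hf : ∀ x ∈ S, f x = c)
    {T : TransMat X} (hT : T ∈ 𝒯) (k : ℕ) : ∀ x ∈ S, (Tf T.apply f)^[k] 0 x = k * c := by
  induction k with
  | zero => intro x _; simp
  | succ k ih =>
    intro x hx
    rw [Function.iterate_succ_apply']
    show f x + ∑ y, T.P x y * _ = _
    have : ∀ y, T.P x y * (Tf T.apply f)^[k] 0 y = T.P x y * (k * c) := by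
      intro y
      by_cases hy : y ∈ S
      · rw [ih y hy]
      · rw [P_zero henv hT (fun h => hy (hS x hx y h)), zero_mul, zero_mul]
    rw [Finset.sum_congr rfl fun y _ => this y, ← Finset.sum_mul, T.rowSum, hf x hx]
    push_cast
    ring

theorem closed_lim (hne : 𝒯.Nonempty) (henv : IsUpperEnv 𝒯 Tbar) {S : Set X}
    (hS : ∀ x ∈ S, ∀ y, Edge Tbar x y → y ∈ S) (f : X → ℝ) (c : ℝ) (hf : ∀ x ∈ S, f x = c)
    (x : X) (hx : x ∈ S) : Tendsto (riSeq 𝒯 f x) atTop (𝓝 c) := by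
  refine tendsto_const_nhds.congr' ?_
  filter_upwards [eventually_gt_atTop 0] with k hk
  have := hne.to_subtype
  have hk' : (k : ℝ) ≠ 0 := by positivity
  have : ∀ T : 𝒯, (1 / (k : ℝ)) * (Tf (TransMat.apply T.1) f)^[k] 0 x = c := fun T => by
    rw [closed_iter henv hS f c hf T.2 k x hx]
    field_simp
  unfold riSeq
  simp only [this, ciSup_const]

theorem exists_final (T : (X → ℝ) → (X → ℝ)) (z : X) :
    ∃ x, Acc' T z x ∧ ∀ y, Acc' T x y → Acc' T y x := by
  obtain ⟨x, hx⟩ := Set.Finite.exists_minimalFor (fun x => {y | Acc' T x y}) {x | Acc' T z x}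
    (Set.toFinite _) ⟨z, .refl⟩
  refine ⟨x, hx.1, fun y hy => ?_⟩
  have := hx.2 (j := y) (Relation.ReflTransGen.trans hx.1 hy)
    (fun w hw => Relation.ReflTransGen.trans hy hw)
  exact this (show Acc' T x x from .refl)

theorem exists_top (hne : 𝒯.Nonempty) (henv : IsUpperEnv 𝒯 Tbar) (hE : RIWeaklyErgodic 𝒯) :
    ∃ R, IsTopClass Tbar R := by
  obtain ⟨x0, -, hx0⟩ := exists_final Tbar (Classical.arbitrary X)
  have key : ∀ z, Acc' Tbar z x0 := by
    intro z
    by_contra hz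
    obtain ⟨x1, hzx, hx1⟩ := exists_final Tbar z
    obtain ⟨μ, hμ⟩ := hE (ind {y | Acc' Tbar x0 y})
    have h1 := closed_lim hne henv (S := {y | Acc' Tbar x0 y})
      (fun x hx y h => Relation.ReflTransGen.tail hx h) (ind {y | Acc' Tbar x0 y}) 1
      (fun x hx => by simp only [ind, Set.indicator_of_mem hx]; rfl) x0 .refl
    have h2 := closed_lim hne henv (S := {y | Acc' Tbar x1 y})
      (fun x hx y h => Relation.ReflTransGen.tail hx h) (ind {y | Acc' Tbar x0 y}) 0
      (fun x hx => by
        have : x ∉ {y | Acc' Tbar x0 y} := fun h =>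
          hz (Relation.ReflTransGen.trans hzx (Relation.ReflTransGen.trans hx (hx0 x h)))
        simp only [ind, Set.indicator_of_notMem this]) x1 .refl
    have e1 := tendsto_nhds_unique h1 (hμ x0)
    have e2 := tendsto_nhds_unique h2 (hμ x1)
    linarith
  exact ⟨{y | Comm Tbar x0 y}, ⟨x0, rfl⟩, fun x y hy =>
    Relation.ReflTransGen.trans (key x) hy.1⟩

theorem stay_iter (T : TransMat X) (B : Set X) (f : X → ℝ) (hf : ∀ x, ind B x ≤ f x) (s : ℝ)
    (hs0 : 0 ≤ s) (hs1 : s ≤ 1) (hB : ∀ x, s * ind B x ≤ T.apply (ind B) x) (k : ℕ) (x : X) :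
    (k * s ^ k) * ind B x ≤ (Tf T.apply f)^[k] 0 x := by
  induction k generalizing x with
  | zero => simp
  | succ k ih =>
    rw [Function.iterate_succ_apply']
    show _ ≤ f x + T.apply _ x
    have h1 := app_mono T (h := fun y => 0 + (k * s ^ k) * ind B y)
      (fun y => by simpa using ih y) x
    rw [app_aff] at h1
    have h2 := mul_le_mul_of_nonneg_left (hB x) (by positivity : 0 ≤ k * s ^ k)
    have h3 : 0 ≤ ind B x := by
      by_cases hx : x ∈ B <;> simp [ind, hx]
    have h4 : s ^ (k + 1) ≤ 1 := pow_le_one₀ hs0 hs1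
    have h5 := mul_le_mul_of_nonneg_right h4 h3
    have h6 := hf x
    rw [pow_succ] at h5 ⊢
    push_cast
    linarith

theorem part2 (hne : 𝒯.Nonempty) (hsep : SepSpec 𝒯) (henv : IsUpperEnv 𝒯 Tbar)
    (hE : RIWeaklyErgodic 𝒯) : TCA Tbar := by
  classical
  obtain ⟨R, hR⟩ := exists_top hne henv hE
  refine ⟨R, hR, ?_⟩
  by_contra hab
  unfold Absorbing at hab
  push Not at hab
  obtain ⟨x, hxR, hx⟩ := hab
  have hcl : ∀ x ∈ R, ∀ y, Edge Tbar x y → y ∈ R := fun x hx y h => top_closed hR hx h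
  have hanti := phi_anti hne henv hcl
  set B : Set X := {x | ∀ k : ℕ, 1 ≤ Tbar^[k] (ind Rᶜ) x} with hBdef
  have h1 : ∀ x, ∃ k : ℕ, x ∉ B → Tbar^[k] (ind Rᶜ) x < 1 := by
    intro x
    by_cases hx : x ∈ B
    · exact ⟨0, fun h => absurd hx h⟩
    · have : ¬ ∀ k : ℕ, 1 ≤ Tbar^[k] (ind Rᶜ) x := hx
      push Not at this
      obtain ⟨k, hk⟩ := this
      exact ⟨k, fun _ => hk⟩
  choose k hk using h1
  obtain ⟨K, hK⟩ := Finite.exists_le k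
  set φ := Tbar^[K] (ind Rᶜ) with hφ
  have hφ1 : ∀ x, φ x ≤ 1 := fun x => by
    have : φ x ≤ ind Rᶜ x := hanti (Nat.zero_le K) x
    refine this.trans ?_
    by_cases hx : x ∈ R <;> simp [ind, hx]
  obtain ⟨w, hw⟩ := Finite.exists_min fun x => if x ∈ B then (1 : ℝ) else 1 - φ x
  set δ := if w ∈ B then (1 : ℝ) else 1 - φ w with hδ
  have hδ0 : 0 < δ := by
    rw [hδ]
    split_ifs with h
    · exact one_pos
    · have := (hanti (hK w) w).trans_lt (hk w h)
      have : φ w < 1 := this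
      linarith
  have hφB : ∀ x, φ x ≤ (1 - δ) + δ * ind B x := by
    intro x
    by_cases hx : x ∈ B
    · simpa [ind, hx] using hφ1 x
    · have := hw x
      simp only [hx, if_false] at this
      simp [ind, hx]
      linarith
  have hstay : ∀ ε > 0, ε ≤ 1 → ∃ T ∈ 𝒯, ∀ x, (1 - ε) * ind B x ≤ T.apply (ind B) x := by
    intro ε hε hε1
    obtain ⟨T, hT, hTo⟩ := env_opt hne hsep henv φ (δ * ε) (by positivity)
    refine ⟨T, hT, fun x => ?_⟩
    by_cases hx : x ∈ B
    · have a1 : 1 ≤ Tbar φ x := by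
        have := hx (K + 1)
        rwa [Function.iterate_succ_apply'] at this
      have a2 := hTo x
      have a3 := app_mono T hφB x
      rw [app_aff] at a3
      have a4 : ind B x = 1 := by simp [ind, hx]
      rw [a4, mul_one]
      have a5 : δ * (1 - ε) ≤ δ * T.apply (ind B) x := by linarith
      exact le_of_mul_le_mul_left a5 hδ0
    · have a4 : ind B x = 0 := by simp [ind, hx]
      rw [a4, mul_zero, ← app_const T 0 x]
      refine app_mono T (fun y => ?_) x
      by_cases hy : y ∈ B <;> simp [ind, hy]
  have hBR : ∀ y, ind B y ≤ ind Rᶜ y := by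
    intro y
    by_cases hy : y ∈ B
    · have : 1 ≤ ind Rᶜ y := hy 0
      simpa [ind, hy] using this
    · have : ind B y = 0 := by simp [ind, hy]
      rw [this]
      by_cases hy : y ∈ R <;> simp [ind, hy]
  obtain ⟨μ, hμ⟩ := hE (ind Rᶜ)
  have hμ0 : μ = 0 := by
    obtain ⟨⟨r, hr⟩, _⟩ := hR
    have hrR : r ∈ R := by rw [hr]; exact ⟨.refl, .refl⟩
    exact tendsto_nhds_unique (hμ r)
      (closed_lim hne henv hcl (ind Rᶜ) 0 (fun x hx => by simp [ind, hx]) r hrR)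
  have hge : ∀ n : ℕ, 0 < n → 1 / 2 ≤ riSeq 𝒯 (ind Rᶜ) x n := by
    intro n hn
    have hn1 : (1 : ℝ) ≤ n := by exact_mod_cast hn
    have he : 1 / (2 * (n : ℝ)) ≤ 1 := by
      rw [div_le_one (by positivity)]; linarith
    obtain ⟨T, hT, hTB⟩ := hstay (1 / (2 * (n : ℝ))) (by positivity) he
    refine le_trans ?_ (le_ciSup (ri_bdd 𝒯 (ind Rᶜ) x n) ⟨T, hT⟩)
    have b1 := stay_iter T B (ind Rᶜ) hBR _ (by linarith)
      (by have : 0 < 1 / (2 * (n : ℝ)) := by positivity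
          linarith) hTB n x
    have b2 : ind B x = 1 := by
      have : x ∈ B := hx
      simp [ind, this]
    rw [b2, mul_one] at b1
    have b3 := one_add_mul_le_pow (a := -(1 / (2 * (n : ℝ)))) (by linarith) n
    rw [← sub_eq_add_neg] at b3
    have hn0 : (n : ℝ) ≠ 0 := by positivity
    have b4 : 1 + (n : ℝ) * -(1 / (2 * (n : ℝ))) = 1 / 2 := by field_simp; norm_num
    rw [b4] at b3
    have b5 := mul_le_mul_of_nonneg_left b1 (by positivity : 0 ≤ 1 / (n : ℝ))
    have b6 : 1 / (n : ℝ) * (n * (1 - 1 / (2 * (n : ℝ))) ^ n) = (1 - 1 / (2 * (n : ℝ))) ^ n := by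
      rw [← mul_assoc, one_div_mul_cancel hn0, one_mul]
    rw [b6] at b5
    exact b3.trans b5
  have := ge_of_tendsto (hμ x) ((eventually_gt_atTop 0).mono hge)
  linarith

end helpers

/-- the imprecise Markov chain under repetition independence associated
with a nonempty separately specified set `𝒯` of transition matrices, with upper
envelope `T̄`, is weakly ergodic iff `T̄` satisfies (TCA); in that case, for every `f`
and `x`, the limits of `sup_{T∈𝒯}(1/k)·[T_f^k(0)](x)` and of `(1/k)·[T̄_f^k(0)](x)`
both exist and coincide. -/
theorem ri_weaklyErgodic_iff_TCA {X : Type*} [Fintype X] [Nonempty X]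
    (𝒯 : Set (TransMat X)) (hne : 𝒯.Nonempty) (hsep : SepSpec 𝒯)
    (Tbar : (X → ℝ) → (X → ℝ)) (henv : IsUpperEnv 𝒯 Tbar) :
    (RIWeaklyErgodic 𝒯 ↔ TCA Tbar) ∧
    (TCA Tbar → ∀ (f : X → ℝ) (x : X), ∃ μ : ℝ,
      Tendsto (riSeq 𝒯 f x) atTop (𝓝 μ) ∧
      Tendsto (fun k : ℕ => (1 / (k : ℝ)) * (Tf Tbar f)^[k] 0 x) atTop (𝓝 μ)) := by
  refine ⟨⟨part2 hne hsep henv, fun h f => ?_⟩, fun h f x => ?_⟩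
  · obtain ⟨μ, hμ⟩ := part1 hne hsep henv h f
    exact ⟨μ, fun x => (hμ x).1⟩
  · obtain ⟨μ, hμ⟩ := part1 hne hsep henv h f
    exact ⟨μ, hμ x⟩

end WeakErg
end

section
/- Let F : ℝ^n → ℝ^n be a topical map. If h₁ and h₂ are additive eigenvectors of F with corresponding additive eigenvalues μ₁ and μ₂, then μ₁ = μ₂ (i.e., if F has an additive eigenvalue, it is unique). -/
open Filter Topology

namespace TopicalMaps

/-- A topical map on ℝⁿ: constantly additive and monotone for the
componentwise order. -/
def Topical {n : ℕ} (F : (Fin n → ℝ) → (Fin n → ℝ)) : Prop :=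
  (∀ (h : Fin n → ℝ) (μ : ℝ), F (h + fun _ => μ) = F h + fun _ => μ) ∧
  (∀ h g : Fin n → ℝ, h ≤ g → F h ≤ F g)

theorem eigenvalue_le {n : ℕ} (hn : 1 ≤ n)
    (F : (Fin n → ℝ) → (Fin n → ℝ)) (hF : Topical F)
    (h₁ h₂ : Fin n → ℝ) (μ₁ μ₂ : ℝ)
    (e₁ : F h₁ = h₁ + fun _ => μ₁) (e₂ : F h₂ = h₂ + fun _ => μ₂) :
    μ₁ ≤ μ₂ := by
  haveI : Nonempty (Fin n) := ⟨⟨0, hn⟩⟩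
  obtain ⟨i, hi⟩ := Finite.exists_max (fun j => h₁ j - h₂ j)
  have hle : h₁ ≤ h₂ + fun _ => (h₁ i - h₂ i) := by
    intro j
    have := hi j
    simp only [Pi.add_apply]
    linarith
  have h := hF.2 _ _ hle i
  rw [hF.1, e₁, e₂] at h
  simp only [Pi.add_apply] at h
  linarith

/-- a topical map has at most one additive eigenvalue. -/
theorem unique_additive_eigenvalue {n : ℕ} (hn : 1 ≤ n)
    (F : (Fin n → ℝ) → (Fin n → ℝ)) (hF : Topical F)
    (h₁ h₂ : Fin n → ℝ) (μ₁ μ₂ : ℝ)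
    (e₁ : F h₁ = h₁ + fun _ => μ₁) (e₂ : F h₂ = h₂ + fun _ => μ₂) :
    μ₁ = μ₂ := by
  exact le_antisymm (eigenvalue_le hn F hF h₁ h₂ μ₁ μ₂ e₁ e₂)
    (eigenvalue_le hn F hF h₂ h₁ μ₂ μ₁ e₂ e₁)

end TopicalMaps
end

section
/- Let F : ℝ^n → ℝ^n be a topical map such that the associated graph 𝒢'(F) is strongly connected. Then F has an additive eigenvector. -/
open Filter Topology

namespace TopicalMaps

/-- Edge of the graph 𝒢'(F): from `i` to `j` iff `[F(α·e_j)]_i → +∞` as `α → +∞`. -/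
def GEdge {n : ℕ} (F : (Fin n → ℝ) → (Fin n → ℝ)) (i j : Fin n) : Prop :=
  Tendsto (fun α : ℝ => F (fun x => if x = j then α else 0) i) atTop atTop

/-- Accessibility in 𝒢'(F): `i = j` or a directed path from `i` to `j`. -/
def GAcc {n : ℕ} (F : (Fin n → ℝ) → (Fin n → ℝ)) : Fin n → Fin n → Prop :=
  Relation.ReflTransGen (GEdge F)

/-- 𝒢'(F) is strongly connected. -/
def GStronglyConnected {n : ℕ} (F : (Fin n → ℝ) → (Fin n → ℝ)) : Prop :=
  ∀ i j : Fin n, GAcc F i j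

lemma topical_lipschitz {n : ℕ} (F : (Fin n → ℝ) → (Fin n → ℝ)) (hF : Topical F) :
    LipschitzWith 1 F := by
  have key : ∀ h g : Fin n → ℝ, ∀ i, F h i - F g i ≤ dist h g := by
    intro h g i
    have h1 : h ≤ g + fun _ => dist h g := by
      intro j
      have h2 := dist_le_pi_dist h g j
      rw [Real.dist_eq] at h2
      have h3 := le_abs_self (h j - g j)
      simp only [Pi.add_apply]
      linarith
    have h2 := hF.2 _ _ h1 i
    rw [hF.1] at h2
    simp only [Pi.add_apply] at h2
    linarith
  apply LipschitzWith.of_dist_le_mul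
  intro h g
  rw [NNReal.coe_one, one_mul, dist_pi_le_iff dist_nonneg]
  intro i
  rw [Real.dist_eq, abs_le]
  have h1 := key h g i
  have h2 := key g h i
  rw [dist_comm] at h2
  constructor <;> linarith

lemma path_bound {n : ℕ} (F : (Fin n → ℝ) → (Fin n → ℝ)) (hF : Topical F) (K : ℝ)
    (i j : Fin n) (hij : GAcc F i j) :
    ∃ B : ℝ, ∀ (l : ℝ) (g : Fin n → ℝ), 1 / 2 ≤ l → 0 ≤ g →
      (∀ x, F (l • g) x ≤ g x + K) → g i = 0 → g j ≤ B := by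
  induction hij with
  | refl => exact ⟨0, fun l g _ _ _ h => h.le⟩
  | @tail b k _ hbk ih =>
    obtain ⟨B, hB⟩ := ih
    obtain ⟨A, hA⟩ := eventually_atTop.1 (hbk.eventually_gt_atTop (B + K))
    refine ⟨2 * max A 0, fun l g hl hg hs hi => ?_⟩
    have h1 := hB l g hl hg hs hi
    by_contra! hlt
    have hm0 : 0 ≤ max A 0 := le_max_right _ _
    have h2 : A ≤ l * g k := by
      have := le_max_left A 0
      nlinarith
    have h3 := hA _ h2
    have h4 : (fun x => if x = k then l * g k else 0) ≤ l • g := by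
      intro x
      have hx : 0 ≤ g x := hg x
      simp only [Pi.smul_apply, smul_eq_mul]
      split_ifs with hxk
      · rw [hxk]
      · positivity
    have h5 := hF.2 _ _ h4 b
    have h6 := hs b
    linarith

lemma discounted {n : ℕ} (hn : 1 ≤ n) (F : (Fin n → ℝ) → (Fin n → ℝ)) (hF : Topical F)
    (K : ℝ) (hK : ∀ i, |F 0 i| ≤ K) (l : ℝ) (hl0 : 0 ≤ l) (hl1 : l < 1) :
    ∃ (g : Fin n → ℝ) (c : ℝ), 0 ≤ g ∧ (∃ i, g i = 0) ∧ |c| ≤ K ∧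
      F (l • g) = g + fun _ => c := by
  have : Nonempty (Fin n) := ⟨⟨0, hn⟩⟩
  have hc : ContractingWith ⟨l, hl0⟩ (fun h => F (l • h)) := by
    refine ⟨by exact_mod_cast hl1, LipschitzWith.of_dist_le_mul fun x y => ?_⟩
    have h1 := (topical_lipschitz F hF).dist_le_mul (l • x) (l • y)
    rw [NNReal.coe_one, one_mul, dist_smul₀, Real.norm_of_nonneg hl0] at h1
    exact h1
  obtain ⟨h, hh⟩ : ∃ h, F (l • h) = h := ⟨_, hc.fixedPoint_isFixedPt⟩
  obtain ⟨i, hi⟩ := Finite.exists_min h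
  obtain ⟨j, hj⟩ := Finite.exists_max h
  have hg0 : (0 : Fin n → ℝ) ≤ fun x => h x - h i := fun x => sub_nonneg.2 (hi x)
  have heq : F (l • fun x => h x - h i) = (fun x => h x - h i) + fun _ => (1 - l) * h i := by
    have e : (l • fun x => h x - h i) = l • h + fun _ => - (l * h i) := by
      ext x; simp; ring
    rw [e, hF.1, hh]
    ext x; simp; ring
  refine ⟨fun x => h x - h i, (1 - l) * h i, hg0, ⟨i, sub_self _⟩, ?_, heq⟩
  rw [abs_le]
  constructor
  · have h1 : (0 : Fin n → ℝ) ≤ l • fun x => h x - h i := smul_nonneg hl0 hg0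
    have h2 := hF.2 _ _ h1 i
    rw [heq] at h2
    simp at h2
    have := (abs_le.1 (hK i)).1
    linarith
  · have h1 : (l • fun x => h x - h i) ≤ 0 + fun _ => l * (h j - h i) := by
      intro x
      simp
      exact mul_le_mul_of_nonneg_left (by linarith [hj x]) hl0
    have h2 := hF.2 _ _ h1 j
    rw [heq, hF.1] at h2
    simp at h2
    have := (abs_le.1 (hK j)).2
    nlinarith [hi j]

/-- a topical map with strongly connected graph 𝒢'(F) has an
additive eigenvector. -/
theorem exists_additive_eigenvector {n : ℕ} (hn : 1 ≤ n)
    (F : (Fin n → ℝ) → (Fin n → ℝ)) (hF : Topical F)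
    (hsc : GStronglyConnected F) :
    ∃ (h : Fin n → ℝ) (μ : ℝ), F h = h + fun _ => μ := by
  obtain ⟨K, hK⟩ := Finite.exists_le (fun i => |F 0 i|)
  choose B hB using fun p : Fin n × Fin n => path_bound F hF K p.1 p.2 (hsc p.1 p.2)
  obtain ⟨M, hM⟩ := Finite.exists_le B
  let l : ℕ → ℝ := fun m => 1 - 1 / 2 * (1 / ((m : ℝ) + 1))
  have hpos : ∀ m : ℕ, 0 < 1 / ((m : ℝ) + 1) := fun m => by positivity
  have hle : ∀ m : ℕ, 1 / ((m : ℝ) + 1) ≤ 1 := fun m => by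
    rw [div_le_one (by positivity)]
    have : (0 : ℝ) ≤ m := by positivity
    linarith
  have hl1 : ∀ m, l m < 1 := fun m => by simp only [l]; linarith [hpos m]
  have hl0 : ∀ m, 1 / 2 ≤ l m := fun m => by simp only [l]; linarith [hle m]
  have hlt : Tendsto l atTop (𝓝 1) := by
    have := (tendsto_one_div_add_atTop_nhds_zero_nat (𝕜 := ℝ)).const_mul (1 / 2)
    simpa [l] using this.const_sub 1
  choose g c hg0 hgi hcK heq using fun m =>
    discounted hn F hF K hK (l m) (by linarith [hl0 m]) (hl1 m)
  have hgM : ∀ m j, g m j ≤ M := by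
    intro m j
    obtain ⟨i, hi⟩ := hgi m
    refine (hB (i, j) (l m) (g m) (hl0 m) (hg0 m) (fun x => ?_) hi).trans (hM _)
    rw [heq m]
    have := (abs_le.1 (hcK m)).2
    simp only [Pi.add_apply]
    linarith
  have hcomp : IsCompact ((Set.Icc (0 : Fin n → ℝ) (fun _ => M)) ×ˢ (Set.Icc (-K) K)) :=
    isCompact_Icc.prod isCompact_Icc
  obtain ⟨⟨h, μ⟩, -, φ, hφ, hlim⟩ := hcomp.tendsto_subseq (x := fun m => (g m, c m))
    (fun m => ⟨⟨hg0 m, hgM m⟩, abs_le.1 (hcK m)⟩)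
  rw [Prod.tendsto_iff] at hlim
  obtain ⟨hg, hc⟩ := hlim
  simp only [Function.comp_def] at hg hc
  refine ⟨h, μ, ?_⟩
  have t1 : Tendsto (fun m => F (l (φ m) • g (φ m))) atTop (𝓝 (F h)) := by
    have := (hlt.comp hφ.tendsto_atTop).smul hg
    rw [one_smul] at this
    exact ((topical_lipschitz F hF).continuous.tendsto h).comp this
  have t2 : Tendsto (fun m => g (φ m) + fun _ : Fin n => c (φ m)) atTop
      (𝓝 (h + fun _ => μ)) := hg.add (tendsto_pi_nhds.2 fun _ => hc)
  refine tendsto_nhds_unique t1 (t2.congr fun m => (heq (φ m)).symm)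

end TopicalMaps
end

section
/- Let T̄ be an upper transition operator on ℒ(X) such that the graph 𝒢(T̄) is strongly connected. Then T̄ is weakly ergodic; moreover, for every f ∈ ℒ(X), the map T̄_f has a unique additive eigenvalue μ_f, and lim_{k→∞} (1/k)·[T̄_f^k(0)](x) = μ_f for every x ∈ X. -/
open Filter Topology

namespace WeakErg

theorem uto_key {X : Type*} [Fintype X] [Nonempty X] {T : (X → ℝ) → (X → ℝ)} (hT : IsUTO T)
    {h g : X → ℝ} {c : ℝ} (H : ∀ y, h y ≤ g y + c) (x : X) : T h x ≤ T g x + c := by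
  have h1 := hT.2.1 g (h - g) x
  have h2 := hT.1 (h - g) x
  have h3 : (⨆ y, (h - g) y) ≤ c := ciSup_le fun y => by
    have := H y
    simp only [Pi.sub_apply]
    linarith
  rw [add_sub_cancel] at h1
  linarith

theorem uto_zero_s6 {X : Type*} [Fintype X] [Nonempty X] {T : (X → ℝ) → (X → ℝ)} (hT : IsUTO T)
    (x : X) : T 0 x = 0 := by
  have := congrFun (hT.2.2 0 le_rfl 0) x
  simpa using this

theorem uto_lip {X : Type*} [Fintype X] [Nonempty X] {T : (X → ℝ) → (X → ℝ)} (hT : IsUTO T)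
    (h g : X → ℝ) (x : X) : |T h x - T g x| ≤ ‖h - g‖ := by
  have hb : ∀ y, |h y - g y| ≤ ‖h - g‖ := fun y => norm_le_pi_norm (h - g) y
  have h1 := uto_key hT (h := h) (g := g) (c := ‖h - g‖)
    (fun y => by have := (abs_le.1 (hb y)).2; linarith) x
  have h2 := uto_key hT (h := g) (g := h) (c := ‖h - g‖)
    (fun y => by have := (abs_le.1 (hb y)).1; linarith) x
  rw [abs_le]
  constructor <;> linarith

theorem tf_iter {X : Type*} [Fintype X] [Nonempty X] {T : (X → ℝ) → (X → ℝ)} (hT : IsUTO T)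
    (f : X → ℝ) {h g : X → ℝ} {c : ℝ} (H : ∀ y, h y ≤ g y + c) (k : ℕ) :
    ∀ x, (Tf T f)^[k] h x ≤ (Tf T f)^[k] g x + c := by
  induction k with
  | zero => simpa using H
  | succ k ih =>
    intro x
    rw [Function.iterate_succ_apply', Function.iterate_succ_apply']
    have := uto_key hT ih x
    simp only [Tf, Pi.add_apply] at *
    linarith

theorem eig_iter {X : Type*} [Fintype X] [Nonempty X] {T : (X → ℝ) → (X → ℝ)} (hT : IsUTO T)
    (f : X → ℝ) {h : X → ℝ} {μ : ℝ} (H : Tf T f h = h + fun _ => μ) (k : ℕ) :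
    ∀ x, (Tf T f)^[k] h x = h x + k * μ := by
  induction k with
  | zero => simp
  | succ k ih =>
    intro x
    rw [Function.iterate_succ_apply']
    have h1 := uto_key hT (h := (Tf T f)^[k] h) (g := h) (c := k * μ) (fun y => (ih y).le) x
    have h2 := uto_key hT (h := h) (g := (Tf T f)^[k] h) (c := - (k * μ))
      (fun y => by rw [ih y]; linarith) x
    have h3 := congrFun H x
    simp only [Tf, Pi.add_apply] at *
    push_cast
    linarith

theorem eig_tendsto {X : Type*} [Fintype X] [Nonempty X] {T : (X → ℝ) → (X → ℝ)} (hT : IsUTO T)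
    (f : X → ℝ) {μ : ℝ} (H : IsAddEigenvalue (Tf T f) μ) (x : X) :
    Tendsto (fun k : ℕ => (1 / (k : ℝ)) * (Tf T f)^[k] 0 x) atTop (𝓝 μ) := by
  obtain ⟨h, H⟩ := H
  have hb : ∀ y, |h y| ≤ ‖h‖ := fun y => norm_le_pi_norm h y
  have key : ∀ k : ℕ, |(Tf T f)^[k] 0 x - k * μ| ≤ 2 * ‖h‖ := by
    intro k
    have h1 := tf_iter hT f (h := 0) (g := h) (c := ‖h‖)
      (fun y => by have := (abs_le.1 (hb y)).1; simp only [Pi.zero_apply]; linarith) k x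
    have h2 := tf_iter hT f (h := h) (g := 0) (c := ‖h‖)
      (fun y => by have := (abs_le.1 (hb y)).2; simp only [Pi.zero_apply]; linarith) k x
    have h3 := eig_iter hT f H k x
    have h4 := abs_le.1 (hb x)
    rw [abs_le]
    constructor <;> linarith [h4.1, h4.2]
  rw [tendsto_iff_norm_sub_tendsto_zero]
  have hlim : Tendsto (fun k : ℕ => (2 * ‖h‖) / (k : ℝ)) atTop (𝓝 0) :=
    tendsto_const_div_atTop_nhds_zero_nat _
  refine squeeze_zero' (Eventually.of_forall fun _ => norm_nonneg _) ?_ hlim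
  filter_upwards [eventually_gt_atTop 0] with k hk
  have hk' : (0 : ℝ) < k := by exact_mod_cast hk
  have : 1 / (k : ℝ) * (Tf T f)^[k] 0 x - μ = ((Tf T f)^[k] 0 x - k * μ) / k := by
    field_simp
  rw [this, Real.norm_eq_abs, abs_div, abs_of_pos hk']
  gcongr
  exact key k

theorem disc_fix_s6 {X : Type*} [Fintype X] [Nonempty X] {T : (X → ℝ) → (X → ℝ)} (hT : IsUTO T)
    (f : X → ℝ) {β : ℝ} (h0 : 0 ≤ β) (h1 : β < 1) :
    ∃ h : X → ℝ, (∀ x, h x = f x + β * T h x) ∧ (1 - β) * ‖h‖ ≤ ‖f‖ := by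
  let G : (X → ℝ) → (X → ℝ) := fun h => f + β • T h
  have hG : ContractingWith ⟨β, h0⟩ G := by
    refine ⟨by exact_mod_cast h1, LipschitzWith.of_dist_le_mul fun h g => ?_⟩
    change dist (G h) (G g) ≤ β * dist h g
    rw [dist_pi_le_iff (by positivity)]
    intro x
    have := uto_lip hT h g x
    rw [Real.dist_eq, dist_eq_norm]
    have e : G h x - G g x = β * (T h x - T g x) := by
      simp only [G, Pi.add_apply, Pi.smul_apply, smul_eq_mul]; ring
    rw [e, abs_mul, abs_of_nonneg h0]
    gcongr
  have hfix : G (hG.fixedPoint G) = hG.fixedPoint G := hG.fixedPoint_isFixedPt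
  generalize hG.fixedPoint G = h at hfix
  have hx : ∀ x, h x = f x + β * T h x := fun x => by
    conv_lhs => rw [← hfix]
    simp [G]
  refine ⟨h, hx, ?_⟩
  have : ‖h‖ ≤ ‖f‖ + β * ‖h‖ := by
    rw [pi_norm_le_iff_of_nonneg (by positivity)]
    intro x
    have h2 := uto_lip hT h 0 x
    rw [uto_zero_s6 hT, sub_zero, sub_zero] at h2
    rw [hx x]
    refine (norm_add_le _ _).trans (add_le_add (norm_le_pi_norm f x) ?_)
    rw [norm_mul, Real.norm_eq_abs, Real.norm_eq_abs, abs_of_nonneg h0]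
    gcongr
  linarith

theorem disc_norm {X : Type*} [Fintype X] [Nonempty X] {T : (X → ℝ) → (X → ℝ)} (hT : IsUTO T)
    (f : X → ℝ) {β : ℝ} (h0 : 0 ≤ β) (h1 : β < 1) :
    ∃ (g : X → ℝ) (c : ℝ), (∀ x, 0 ≤ g x) ∧ (∃ x, g x = 0) ∧ |c| ≤ ‖f‖ ∧
      ∀ x, g x + c = f x + β * T g x := by
  obtain ⟨h, hx, hn⟩ := disc_fix_s6 hT f h0 h1
  obtain ⟨x0, hx0⟩ := Finite.exists_min h
  refine ⟨fun x => h x - h x0, (1 - β) * h x0, fun x => sub_nonneg.2 (hx0 x), ⟨x0, sub_self _⟩,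
    ?_, fun x => ?_⟩
  · rw [abs_mul, abs_of_pos (by linarith)]
    refine le_trans ?_ hn
    have : |h x0| ≤ ‖h‖ := norm_le_pi_norm h x0
    have : 0 < 1 - β := by linarith
    gcongr
  · have a := uto_key hT (h := h) (g := fun x => h x - h x0) (c := h x0) (fun y => by simp) x
    have b := uto_key hT (g := h) (h := fun x => h x - h x0) (c := - h x0)
      (fun y => by linarith) x
    have e : T (fun x => h x - h x0) x = T h x - h x0 := by linarith
    have hxx := hx x
    rw [e]
    simp only
    linear_combination hxx

theorem edge_bound {X : Type*} [Fintype X] [Nonempty X] {T : (X → ℝ) → (X → ℝ)} (hT : IsUTO T)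
    {x y : X} {g : X → ℝ} (hg : ∀ x, 0 ≤ g x) : g y * T (ind {y}) x ≤ T g x := by
  have h1 := congrFun (hT.2.2 (g y) (hg y) (ind {y})) x
  have h2 := uto_key hT (h := g y • ind {y}) (g := g) (c := 0) (fun z => by
    by_cases hz : z = y
    · simp [ind, hz]
    · simp [ind, hz, hg z]) x
  simp only [Pi.smul_apply, smul_eq_mul] at h1
  linarith

theorem path_bound_s6 {X : Type*} [Fintype X] [Nonempty X] {T : (X → ℝ) → (X → ℝ)} (hT : IsUTO T)
    (F : ℝ) {x y : X} (hxy : Acc' T x y) :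
    ∃ C : ℝ, ∀ g : X → ℝ, (∀ x, 0 ≤ g x) → (∀ x, T g x ≤ 2 * (g x + F)) → g x = 0 →
      g y ≤ C := by
  induction hxy with
  | refl => exact ⟨0, fun g _ _ h => h.le⟩
  | @tail y z _ hyz ih =>
    obtain ⟨C, hC⟩ := ih
    refine ⟨2 * (C + F) / T (ind {z}) y, fun g hg hTg hx => ?_⟩
    have h1 := hC g hg hTg hx
    have h2 := edge_bound hT (x := y) (y := z) hg
    have h3 := hTg y
    have h4 : 0 < T (ind {z}) y := hyz
    rw [le_div_iff₀ h4]
    linarith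

theorem unif_bound {X : Type*} [Fintype X] [Nonempty X] {T : (X → ℝ) → (X → ℝ)} (hT : IsUTO T)
    (hsc : StronglyConnected T) (F : ℝ) :
    ∃ C : ℝ, ∀ g : X → ℝ, (∀ x, 0 ≤ g x) → (∀ x, T g x ≤ 2 * (g x + F)) → (∃ x, g x = 0) →
      ∀ y, g y ≤ C := by
  choose C hC using fun p : X × X => path_bound_s6 hT F (hsc p.1 p.2)
  obtain ⟨p, hp⟩ := Finite.exists_max C
  exact ⟨C p, fun g hg hTg ⟨x, hx⟩ y => (hC (x, y) g hg hTg hx).trans (hp _)⟩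

theorem exists_eig {X : Type*} [Fintype X] [Nonempty X] {T : (X → ℝ) → (X → ℝ)} (hT : IsUTO T)
    (hsc : StronglyConnected T) (f : X → ℝ) : ∃ μ, IsAddEigenvalue (Tf T f) μ := by
  obtain ⟨C, hC⟩ := unif_bound hT hsc (2 * ‖f‖)
  let β : ℕ → ℝ := fun n => 1 - 1 / 2 * (1 / ((n : ℝ) + 1))
  have hβ : ∀ n, 1 / 2 ≤ β n ∧ β n < 1 := fun n => by
    have h1 : 0 < 1 / ((n : ℝ) + 1) := by positivity
    have h2 : 1 / ((n : ℝ) + 1) ≤ 1 := by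
      rw [div_le_one (by positivity)]
      have : (0 : ℝ) ≤ n := by positivity
      linarith
    simp only [β]
    constructor <;> linarith
  have hβlim : Tendsto β atTop (𝓝 1) := by
    have := (tendsto_one_div_add_atTop_nhds_zero_nat (𝕜 := ℝ)).const_mul (1 / 2)
    simpa [β] using this.const_sub 1
  choose g c hg hz hc he using fun n =>
    disc_norm hT f (β := β n) (by linarith [(hβ n).1]) (hβ n).2
  have hgC : ∀ n y, g n y ≤ C := fun n => by
    refine hC (g n) (hg n) (fun x => ?_) (hz n)
    have h1 := he n x
    have h2 := abs_le.1 (hc n)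
    have h3 : |f x| ≤ ‖f‖ := norm_le_pi_norm f x
    have h3 := abs_le.1 h3
    have h4 : 0 ≤ T (g n) x := by
      have := uto_key hT (h := 0) (g := g n) (c := 0) (fun y => by simpa using hg n y) x
      rw [uto_zero_s6 hT] at this
      linarith
    have h5 : 1 / 2 * T (g n) x ≤ β n * T (g n) x := by
      have := (hβ n).1
      gcongr
    linarith [h2.1, h2.2, h3.1, h3.2]
  have hK : IsCompact (Set.Icc (0 : X → ℝ) (fun _ => C) ×ˢ Set.Icc (-‖f‖) ‖f‖) :=
    isCompact_Icc.prod isCompact_Icc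
  obtain ⟨⟨h, μ⟩, -, φ, hφ, hlim⟩ := hK.tendsto_subseq (x := fun n => (g n, c n))
    (fun n => ⟨⟨fun x => hg n x, fun x => hgC n x⟩, abs_le.1 (hc n)⟩)
  have hl1 : Tendsto (fun n => g (φ n)) atTop (𝓝 h) := (continuous_fst.tendsto _).comp hlim
  have hl2 : Tendsto (fun n => c (φ n)) atTop (𝓝 μ) := (continuous_snd.tendsto _).comp hlim
  refine ⟨μ, h, funext fun x => ?_⟩
  have hTl : Tendsto (fun n => T (g (φ n)) x) atTop (𝓝 (T h x)) := by
    rw [tendsto_iff_norm_sub_tendsto_zero] at hl1 ⊢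
    exact squeeze_zero (fun _ => norm_nonneg _) (fun n => uto_lip hT _ _ x) hl1
  have l1 := ((tendsto_pi_nhds.1 hl1) x).add hl2
  have l2 := ((hβlim.comp hφ.tendsto_atTop).mul hTl).const_add (f x)
  have := tendsto_nhds_unique (l1.congr fun n => he (φ n) x) l2
  simp only [Tf, Pi.add_apply]
  linarith

/-- if 𝒢(T̄) is strongly connected then `T̄` is weakly ergodic;
moreover, for every `f`, `T̄_f` has a unique additive eigenvalue `μ_f`, and
`(1/k)·[T̄_f^k(0)](x) → μ_f` for every `x`. -/
theorem stronglyConnected_weaklyErgodic {X : Type*} [Fintype X] [Nonempty X]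
    (T : (X → ℝ) → (X → ℝ)) (hT : IsUTO T) (hsc : StronglyConnected T) :
    WeaklyErgodic T ∧
    ∀ f : X → ℝ, ∃ μ : ℝ,
      IsAddEigenvalue (Tf T f) μ ∧
      (∀ μ' : ℝ, IsAddEigenvalue (Tf T f) μ' → μ' = μ) ∧
      ∀ x : X, Tendsto (fun k : ℕ => (1 / (k : ℝ)) * (Tf T f)^[k] 0 x) atTop (𝓝 μ) := by
  have key : ∀ f : X → ℝ, ∃ μ : ℝ,
      IsAddEigenvalue (Tf T f) μ ∧
      (∀ μ' : ℝ, IsAddEigenvalue (Tf T f) μ' → μ' = μ) ∧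
      ∀ x : X, Tendsto (fun k : ℕ => (1 / (k : ℝ)) * (Tf T f)^[k] 0 x) atTop (𝓝 μ) := by
    intro f
    obtain ⟨μ, hμ⟩ := exists_eig hT hsc f
    refine ⟨μ, hμ, fun μ' h' => ?_, eig_tendsto hT f hμ⟩
    obtain ⟨x⟩ := ‹Nonempty X›
    exact tendsto_nhds_unique (eig_tendsto hT f h' x) (eig_tendsto hT f hμ x)
  refine ⟨fun f => ?_, key⟩
  obtain ⟨μ, -, -, h⟩ := key f
  exact ⟨μ, h⟩

end WeakErg
end

section
/- Let 𝒯 be a nonempty, separately specified set of transition matrices on X with upper envelope T̄, and let f ∈ ℒ(X). If T̄_f has an additive eigenvalue μ, then for every ε > 0 there exists T ∈ 𝒯 such that, for every x ∈ X, μ − ε ≤ liminf_{k→∞} (1/k)·[T_f^k(0)](x) and limsup_{k→∞} (1/k)·[T_f^k(0)](x) ≤ μ. -/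
open Filter Topology

namespace WeakErg

lemma apply_mono' {X : Type*} [Fintype X] (T : TransMat X) {g h : X → ℝ}
    (H : ∀ x, g x ≤ h x) (x : X) : T.apply g x ≤ T.apply h x :=
  Finset.sum_le_sum fun y _ => mul_le_mul_of_nonneg_left (H y) (T.nonneg x y)

lemma apply_add_const {X : Type*} [Fintype X] (T : TransMat X) (h : X → ℝ) (c : ℝ) (x : X) :
    T.apply (fun y => h y + c) x = T.apply h x + c := by
  simp only [TransMat.apply, mul_add, Finset.sum_add_distrib, ← Finset.sum_mul, T.rowSum, one_mul]

lemma exists_near {X : Type*} [Fintype X] (𝒯 : Set (TransMat X)) (hne : 𝒯.Nonempty)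
    (hsep : SepSpec 𝒯) (Tbar : (X → ℝ) → (X → ℝ)) (henv : IsUpperEnv 𝒯 Tbar)
    (h : X → ℝ) (ε : ℝ) (hε : 0 < ε) (s : Finset X) :
    ∃ T ∈ 𝒯, ∀ x ∈ s, Tbar h x - ε ≤ T.apply h x := by
  classical
  induction s using Finset.induction_on with
  | empty => exact ⟨hne.some, hne.some_mem, by simp⟩
  | insert a s ha ih =>
    obtain ⟨T₁, h₁, H₁⟩ := ih
    haveI : Nonempty 𝒯 := hne.to_subtype
    have : Tbar h a - ε < ⨆ T : 𝒯, TransMat.apply T.1 h a := by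
      rw [← henv]; linarith
    obtain ⟨⟨T₂, h₂⟩, H₂⟩ := exists_lt_of_lt_ciSup this
    obtain ⟨T₃, h₃, A, B⟩ := hsep T₂ h₂ T₁ h₁ {a}
    refine ⟨T₃, h₃, fun x hx => ?_⟩
    rcases eq_or_ne x a with rfl | hxa
    · have := A x rfl
      simp only [TransMat.apply, this] at H₂ ⊢
      exact H₂.le
    · have h4 := B x hxa
      have h5 := H₁ x (Finset.mem_of_mem_insert_of_ne hx hxa)
      simp only [TransMat.apply, h4] at h5 ⊢
      exact h5

lemma apply_le_env {X : Type*} [Fintype X] (𝒯 : Set (TransMat X))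
    (Tbar : (X → ℝ) → (X → ℝ)) (henv : IsUpperEnv 𝒯 Tbar)
    (h : X → ℝ) (C : ℝ) (hC : ∀ x, h x ≤ C) (T : TransMat X) (hT : T ∈ 𝒯) (x : X) :
    T.apply h x ≤ Tbar h x := by
  rw [henv]
  refine le_ciSup (f := fun T : 𝒯 => TransMat.apply T.1 h x) ⟨C, ?_⟩ ⟨T, hT⟩
  rintro _ ⟨S, rfl⟩
  calc TransMat.apply S.1 h x ≤ TransMat.apply S.1 (fun _ => C) x := apply_mono' _ hC x
    _ = C := by simp only [TransMat.apply, ← Finset.sum_mul, S.1.rowSum, one_mul]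

/-- if `T̄_f` has an additive eigenvalue `μ`, then for every `ε > 0`
there is a `T ∈ 𝒯` whose expected time averages eventually lie between `μ - ε`
and `μ`, in the liminf/limsup sense, for every initial state. -/
theorem exists_transMat_near_eigenvalue {X : Type*} [Fintype X] [Nonempty X]
    (𝒯 : Set (TransMat X)) (hne : 𝒯.Nonempty) (hsep : SepSpec 𝒯)
    (Tbar : (X → ℝ) → (X → ℝ)) (henv : IsUpperEnv 𝒯 Tbar)
    (f : X → ℝ) (μ : ℝ) (hμ : IsAddEigenvalue (Tf Tbar f) μ) :
    ∀ ε : ℝ, 0 < ε → ∃ T ∈ 𝒯, ∀ x : X,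
      μ - ε ≤ Filter.liminf
          (fun k : ℕ => (1 / (k : ℝ)) * (Tf (TransMat.apply T) f)^[k] 0 x) atTop ∧
      Filter.limsup
          (fun k : ℕ => (1 / (k : ℝ)) * (Tf (TransMat.apply T) f)^[k] 0 x) atTop ≤ μ := by
  intro ε hε
  obtain ⟨h, hh⟩ := hμ
  obtain ⟨C, hC⟩ : ∃ C : ℝ, ∀ x, |h x| ≤ C := by
    obtain ⟨C, hC⟩ := (Set.finite_range fun x => |h x|).bddAbove
    exact ⟨C, fun x => hC ⟨x, rfl⟩⟩
  have hh' : ∀ x, f x + Tbar h x = h x + μ := fun x => congrFun hh x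
  obtain ⟨T, hT, hTn⟩ := exists_near 𝒯 hne hsep Tbar henv h ε hε Finset.univ
  refine ⟨T, hT, fun x => ?_⟩
  have hup : ∀ (k : ℕ) (x : X), (Tf (TransMat.apply T) f)^[k] 0 x ≤ h x + (C + k * μ) := by
    intro k
    induction k with
    | zero => intro x; have := abs_le.1 (hC x); simp; linarith
    | succ k ih =>
      intro x
      rw [Function.iterate_succ_apply']
      have h1 := apply_mono' T ih x
      rw [apply_add_const] at h1
      have h2 := apply_le_env 𝒯 Tbar henv h C (fun x => (abs_le.1 (hC x)).2) T hT x
      have h3 := hh' x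
      simp only [Tf, Pi.add_apply] at h1 ⊢
      push_cast
      linarith
  have hlo : ∀ (k : ℕ) (x : X),
      h x + (-C + k * (μ - ε)) ≤ (Tf (TransMat.apply T) f)^[k] 0 x := by
    intro k
    induction k with
    | zero => intro x; have := abs_le.1 (hC x); simp; linarith
    | succ k ih =>
      intro x
      rw [Function.iterate_succ_apply']
      have h1 := apply_mono' T ih x
      rw [apply_add_const] at h1
      have h2 := hTn x (Finset.mem_univ x)
      have h3 := hh' x
      simp only [Tf, Pi.add_apply] at h1 ⊢
      push_cast
      linarith
  have hlim : ∀ c d : ℝ, Tendsto (fun k : ℕ => c * (1 / (k : ℝ)) + d) atTop (𝓝 d) := by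
    intro c d
    simpa using (tendsto_one_div_atTop_nhds_zero_nat (𝕜 := ℝ)).const_mul c |>.add_const d
  have hU : (fun k : ℕ => (1 / (k : ℝ)) * (Tf (TransMat.apply T) f)^[k] 0 x) ≤ᶠ[atTop]
      fun k : ℕ => (h x + C) * (1 / (k : ℝ)) + μ := by
    filter_upwards [eventually_gt_atTop 0] with k hk
    have hk' : (0 : ℝ) < k := by exact_mod_cast hk
    have := mul_le_mul_of_nonneg_left (hup k x) (one_div_pos.2 hk').le
    refine this.trans (le_of_eq ?_)
    field_simp
    ring
  have hL : (fun k : ℕ => (h x - C) * (1 / (k : ℝ)) + (μ - ε)) ≤ᶠ[atTop]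
      (fun k : ℕ => (1 / (k : ℝ)) * (Tf (TransMat.apply T) f)^[k] 0 x) := by
    filter_upwards [eventually_gt_atTop 0] with k hk
    have hk' : (0 : ℝ) < k := by exact_mod_cast hk
    have := mul_le_mul_of_nonneg_left (hlo k x) (one_div_pos.2 hk').le
    refine (le_of_eq ?_).trans this
    field_simp
    ring
  have lU := hlim (h x + C) μ
  have lL := hlim (h x - C) (μ - ε)
  constructor
  · rw [← lL.liminf_eq]
    exact liminf_le_liminf hL lL.isBoundedUnder_ge
      (lU.isBoundedUnder_le.mono_le hU).isCoboundedUnder_ge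
  · rw [← lU.limsup_eq]
    exact limsup_le_limsup hU (lL.isBoundedUnder_ge.mono_ge hL).isCoboundedUnder_le
      lU.isBoundedUnder_le

end WeakErg
end
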